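/- arXiv:2212.12655 — 13 statements merged into one kernel-verified Lean document; each statement's English description precedes it below -/
import Mathlib

section
/- Let n ≥ 3 and let σ and τ be cycles in Sym(n), each of length at least 3, whose supports intersect exactly in the two-element set {a, b} (a ≠ b). Then the product στ is a cycle if and only if (σ(a) = b and τ(b) = a) or (σ(b) = a and τ(a) = b). -/
open Equiv Equiv.Perm in
theorem aux_one {α : Type*} [Fintype α] [DecidableEq α] (f g : Perm α) (hf : f.IsCycle)
    (hg : g.IsCycle) (a : α) (hfa : f a ≠ a) (hga : g a ≠ a)
    (h : ∀ x, f x ≠ x → g x ≠ x → x = a) : (f * g).IsCycle := by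
  have hg1 : ∀ i : ℕ, (f * g).SameCycle a ((g ^ i) a) := by
    intro i
    induction i with
    | zero => exact SameCycle.refl _ _
    | succ i ih =>
      by_cases h1 : (g ^ (i + 1)) a = a
      · rw [h1]
      · have h2 : g ((g ^ (i + 1)) a) ≠ (g ^ (i + 1)) a := by
          intro h3
          have h4 : (g ^ (i + 1)) (g a) = (g ^ (i + 1)) a := by
            rw [← Perm.mul_apply, ← pow_succ, pow_succ', Perm.mul_apply]; exact h3
          exact hga ((g ^ (i + 1)).injective h4)
        have h5 : f ((g ^ (i + 1)) a) = (g ^ (i + 1)) a := by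
          by_contra h6
          exact h1 (h _ h6 h2)
        have h7 : (f * g) ((g ^ i) a) = (g ^ (i + 1)) a := by
          rw [Perm.mul_apply, ← Perm.mul_apply g, ← pow_succ', h5]
        rw [← h7]
        exact sameCycle_apply_right.2 ih
  have hg2 : ∀ x, g x ≠ x → (f * g).SameCycle a x := by
    intro x hx
    obtain ⟨i, rfl⟩ := hg.exists_pow_eq hga hx
    exact hg1 i
  have hf1 : ∀ i : ℕ, (f * g).SameCycle a ((f ^ i) a) := by
    intro i
    induction i with
    | zero => exact SameCycle.refl _ _
    | succ i ih =>
      rw [pow_succ', Perm.mul_apply]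
      generalize (f ^ i) a = y at ih
      by_cases h1 : g y = y
      · have h7 : (f * g) y = f y := by rw [Perm.mul_apply, h1]
        rw [← h7]
        exact sameCycle_apply_right.2 ih
      · by_cases h2 : f y = y
        · rwa [h2]
        · have := h _ h2 h1
          subst this
          have h7 : (f * g) (g⁻¹ y) = f y := by simp
          rw [← h7]
          refine sameCycle_apply_right.2 (hg2 _ ?_)
          intro h8
          apply h1
          have h9 : y = g⁻¹ y := by simpa using h8
          rw [Perm.eq_inv_iff_eq] at h9
          exact h9
  have hf2 : ∀ x, f x ≠ x → (f * g).SameCycle a x := by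
    intro x hx
    obtain ⟨i, rfl⟩ := hf.exists_pow_eq hfa hx
    exact hf1 i
  refine ⟨a, ?_, ?_⟩
  · have h1 : g (g a) ≠ g a := fun h => hga (g.injective h)
    have h2 : f (g a) = g a := by
      by_contra h3
      exact hga (h _ h3 h1)
    rw [Perm.mul_apply, h2]
    exact hga
  · intro y hy
    by_cases h1 : g y = y
    · apply hf2
      rwa [Perm.mul_apply, h1] at hy
    · exact hg2 y h1

open Equiv Equiv.Perm in
theorem aux_bwd {α : Type*} [Fintype α] [DecidableEq α] (f g : Perm α) (hf : f.IsCycle)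
    (hg : g.IsCycle) (a b : α) (hab : a ≠ b)
    (h : ∀ x, f x ≠ x → g x ≠ x → x = a ∨ x = b)
    (h1 : f a = b) (h2 : g b = a) (h3 : f b ≠ a) (h4 : g a ≠ b)
    (hfb : f b ≠ b) (hga : g a ≠ a) :
    (f * g).IsCycle := by
  have e : f * g = (f * swap a b) * (swap a b * g) := by
    rw [mul_assoc, ← mul_assoc (swap a b), swap_mul_self, one_mul]
  have c2 : (swap a b * g).IsCycle := by
    have := hg.swap_mul (x := b) (by rw [h2]; exact hab) (by rw [h2]; exact h4)
    rwa [h2, swap_comm] at this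
  have i1 : f⁻¹ b = a := by rw [Perm.inv_eq_iff_eq, h1]
  have c1 : (f * swap a b).IsCycle := by
    have := hf.inv.swap_mul (x := b) (by rw [i1]; exact hab) (by
      rw [i1]; intro h; rw [Perm.inv_eq_iff_eq] at h; exact h3 h.symm)
    rw [i1] at this
    have := this.inv
    rwa [mul_inv_rev, inv_inv, swap_inv, swap_comm] at this
  rw [e]
  refine aux_one _ _ c1 c2 a (by simpa using h3) ?_ ?_
  · rw [Perm.mul_apply, swap_apply_of_ne_of_ne hga h4]
    exact hga
  · intro x hx hx'
    by_contra hxa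
    have hxb : x ≠ b := by
      rintro rfl
      simp [h1] at hx
    rw [Perm.mul_apply, swap_apply_of_ne_of_ne hxa hxb] at hx
    have : g x = x := by
      by_contra hh
      rcases h x hx hh with h | h <;> contradiction
    rw [Perm.mul_apply, this, swap_apply_of_ne_of_ne hxa hxb] at hx'
    exact hx' rfl

open Equiv Equiv.Perm in
theorem aux_three {α : Type*} [Fintype α] [DecidableEq α] (f : Perm α) (hf : f.IsCycle)
    (h3 : 3 ≤ f.support.card) (a b : α) (hab : a ≠ b) (h1 : f a = b) (h2 : f b = a) : False := by
  have hs : f = swap a (f a) :=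
    hf.eq_swap_of_apply_apply_eq_self (by rw [h1]; exact hab.symm) (by rw [h1, h2])
  rw [h1] at hs
  rw [hs, card_support_swap hab] at h3
  omega

/-- Proposition 2.1: if `σ`, `τ` are cycles of length at least 3 whose supports intersect
exactly in `{a, b}`, then `σ * τ` is a cycle iff `(σ a = b ∧ τ b = a)` or
`(σ b = a ∧ τ a = b)`. -/
theorem stmt0 (n : ℕ) (hn : 3 ≤ n) (σ τ : Equiv.Perm (Fin n))
    (hσ : σ.IsCycle) (hτ : τ.IsCycle)
    (hσ3 : 3 ≤ σ.support.card) (hτ3 : 3 ≤ τ.support.card)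
    (a b : Fin n) (hab : a ≠ b)
    (hint : σ.support ∩ τ.support = {a, b}) :
    (σ * τ).IsCycle ↔ (σ a = b ∧ τ b = a) ∨ (σ b = a ∧ τ a = b) := by
  have hm : ∀ x, (σ x ≠ x ∧ τ x ≠ x) ↔ (x = a ∨ x = b) := by
    intro x
    have := Finset.ext_iff.1 hint x
    simpa using this
  have ha := (hm a).2 (Or.inl rfl)
  have hb := (hm b).2 (Or.inr rfl)
  constructor
  · intro hc
    by_contra hno
    have hsupp : (σ * τ).support = σ.support ∪ τ.support := by
      ext x
      rw [Finset.mem_union, Equiv.Perm.mem_support, Equiv.Perm.mem_support,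
        Equiv.Perm.mem_support, Equiv.Perm.mul_apply]
      constructor
      · intro hx
        by_contra! hh
        rw [hh.2, hh.1] at hx
        exact hx rfl
      · intro hx he
        by_cases hτx : τ x = x
        · rw [hτx] at he
          tauto
        · have hy1 : τ (τ x) ≠ τ x := fun h => hτx (τ.injective h)
          have hy2 : σ (τ x) ≠ τ x := by rw [he]; exact fun h => hτx h.symm
          have hx2 : σ x ≠ x := by
            intro h
            rw [← he] at h
            have := σ.injective h
            exact hy2 this
          have k1 := (hm x).1 ⟨hx2, hτx⟩
          have k2 := (hm (τ x)).1 ⟨hy2, hy1⟩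
          rcases k1 with rfl | rfl <;> rcases k2 with k2 | k2
          · exact hτx k2
          · rw [k2] at he; exact hno (Or.inr ⟨he, k2⟩)
          · rw [k2] at he; exact hno (Or.inl ⟨he, k2⟩)
          · exact hτx k2
    have hcard := Finset.card_union_add_card_inter σ.support τ.support
    rw [hint, Finset.card_pair hab, ← hsupp] at hcard
    have s := hc.sign
    rw [Equiv.Perm.sign_mul, hσ.sign, hτ.sign, neg_mul_neg, ← pow_add, ← hcard, pow_add] at s
    rcases neg_one_pow_eq_or ℤˣ (σ * τ).support.card with h | h <;> rw [h] at s <;>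
      exact absurd s (by decide)
  · rintro (⟨h1, h2⟩ | ⟨h1, h2⟩)
    · exact aux_bwd σ τ hσ hτ a b hab (fun x h h' => (hm x).1 ⟨h, h'⟩) h1 h2
        (fun h => aux_three σ hσ hσ3 a b hab h1 h)
        (fun h => aux_three τ hτ hτ3 a b hab h h2) hb.1 ha.2
    · exact aux_bwd σ τ hσ hτ b a hab.symm (fun x h h' => ((hm x).1 ⟨h, h'⟩).symm) h1 h2
        (fun h => aux_three σ hσ hσ3 a b hab h h1)
        (fun h => aux_three τ hτ hτ3 a b hab h2 h) ha.1 hb.2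
end

section
/- Let n ≥ 5. Then every clique of the Birkhoff polytope graph G(Ω_n) consisting entirely of transpositions has size at most n − 1; the set T_1(n) = {(k, n) : 1 ≤ k ≤ n−1} is a clique of size n − 1; and every clique of transpositions of size n − 1 consists of all transpositions through one common point, i.e., equals {(k, a) : k ∈ {1,…,n}, k ≠ a} for some fixed a. In particular, T_1(n) is the unique maximum clique of transpositions up to conjugation by a permutation. -/
/-- Two permutations `σ`, `τ` are adjacent in the Birkhoff polytope graph `G(Ω_n)` iff
`σ⁻¹ * τ` is a cycle.  A clique is a set of pairwise adjacent permutations. -/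
def IsBClique {n : ℕ} (S : Set (Equiv.Perm (Fin n))) : Prop :=
  S.Pairwise fun σ τ => (σ⁻¹ * τ).IsCycle

/-- `T₁(n)`: the star of all transpositions through the point `z`. -/
def T1set (n : ℕ) (z : Fin n) : Set (Equiv.Perm (Fin n)) :=
  {σ | ∃ k : Fin n, k ≠ z ∧ σ = Equiv.swap k z}

open Equiv in
theorem meet_aux {n : ℕ} {a b c d : Fin n} (hab : a ≠ b) (hcd : c ≠ d)
    (h : ((swap a b)⁻¹ * swap c d).IsCycle) : a = c ∨ a = d ∨ b = c ∨ b = d := by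
  by_contra! hne
  obtain ⟨h1, h2, h3, h4⟩ := hne
  rw [swap_inv] at h
  have fa : (swap a b * swap c d) a = b := by
    rw [Perm.mul_apply, swap_apply_of_ne_of_ne h1 h2, swap_apply_left]
  have fb : (swap a b * swap c d) b = a := by
    rw [Perm.mul_apply, swap_apply_of_ne_of_ne h3 h4, swap_apply_right]
  have fc : (swap a b * swap c d) c = d := by
    rw [Perm.mul_apply, swap_apply_left, swap_apply_of_ne_of_ne h2.symm h4.symm]
  have e := h.eq_swap_of_apply_apply_eq_self (x := a) (by rw [fa]; exact hab.symm) (by rw [fa, fb])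
  rw [fa] at e
  rw [e, swap_apply_of_ne_of_ne h1.symm h3.symm] at fc
  exact hcd fc

open Equiv in
theorem star_aux {n : ℕ} (S : Finset (Perm (Fin n))) (hS : ∀ σ ∈ S, σ.IsSwap)
    (hc : IsBClique (S : Set (Perm (Fin n)))) (h3 : 3 < S.card) :
    ∃ a : Fin n, (S : Set (Perm (Fin n))) ⊆ T1set n a := by
  have meet : ∀ a b c d : Fin n, a ≠ b → c ≠ d → swap a b ∈ S → swap c d ∈ S →
      a = c ∨ a = d ∨ b = c ∨ b = d := by
    intro a b c d hab hcd h1 h2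
    by_cases he : swap a b = swap c d
    · have : swap c d a = b := by rw [← he, swap_apply_left]
      by_contra! hne
      rw [swap_apply_of_ne_of_ne hne.1 hne.2.1] at this
      exact hab this
    · exact meet_aux hab hcd (hc h1 h2 he)
  obtain ⟨σ, hσ, τ, hτ, hne⟩ := Finset.one_lt_card.1 (by omega : 1 < S.card)
  have key : ∃ a b c : Fin n, a ≠ b ∧ a ≠ c ∧ b ≠ c ∧ swap a b ∈ S ∧ swap a c ∈ S := by
    obtain ⟨a, b, hab, rfl⟩ := hS σ hσ
    obtain ⟨c, d, hcd, rfl⟩ := hS τ hτ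
    rcases meet a b c d hab hcd hσ hτ with rfl | rfl | rfl | rfl
    · exact ⟨a, b, d, hab, hcd, by rintro rfl; exact hne rfl, hσ, hτ⟩
    · exact ⟨a, b, c, hab, hcd.symm, by rintro rfl; exact hne (swap_comm _ _), hσ,
        by rwa [swap_comm]⟩
    · exact ⟨b, a, d, hab.symm, hcd, by rintro rfl; exact hne (swap_comm _ _),
        by rwa [swap_comm], hτ⟩
    · exact ⟨b, a, c, hab.symm, hcd.symm, by rintro rfl; exact hne rfl,
        by rwa [swap_comm], by rwa [swap_comm]⟩
  obtain ⟨a, b, c, hab, hac, hbc, h1, h2⟩ := key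
  refine ⟨a, fun ρ hρ => ?_⟩
  by_contra hstar
  have hbcS : swap b c ∈ S := by
    obtain ⟨x, y, hxy, rfl⟩ := hS ρ hρ
    have hx : x ≠ a := by
      rintro rfl; exact hstar ⟨y, hxy.symm, swap_comm _ _⟩
    have hy : y ≠ a := by
      rintro rfl; exact hstar ⟨x, hxy, rfl⟩
    have m1 := meet _ _ _ _ hab hxy h1 hρ
    have m2 := meet _ _ _ _ hac hxy h2 hρ
    have : (x = b ∧ y = c) ∨ (x = c ∧ y = b) := by grind
    rcases this with ⟨rfl, rfl⟩ | ⟨rfl, rfl⟩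
    · exact hρ
    · rw [swap_comm]; exact hρ
  have hsub : S ⊆ {swap a b, swap a c, swap b c} := by
    intro π hπ
    obtain ⟨x, y, hxy, rfl⟩ := hS π hπ
    have m1 := meet _ _ _ _ hab hxy h1 hπ
    have m2 := meet _ _ _ _ hac hxy h2 hπ
    have m3 := meet _ _ _ _ hbc hxy hbcS hπ
    have : (x = a ∧ y = b) ∨ (x = b ∧ y = a) ∨ (x = a ∧ y = c) ∨ (x = c ∧ y = a) ∨
      (x = b ∧ y = c) ∨ (x = c ∧ y = b) := by grind
    simp only [Finset.mem_insert, Finset.mem_singleton]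
    rcases this with ⟨rfl, rfl⟩ | ⟨rfl, rfl⟩ | ⟨rfl, rfl⟩ | ⟨rfl, rfl⟩ | ⟨rfl, rfl⟩ | ⟨rfl, rfl⟩ <;>
      simp [swap_comm]
  have := Finset.card_le_card hsub
  have := Finset.card_le_three (a := swap a b) (b := swap a c) (c := swap b c)
  omega

open Equiv in
theorem T1_ncard {n : ℕ} (z : Fin n) : (T1set n z).ncard = n - 1 := by
  have : T1set n z = (fun k => swap k z) '' (({z}ᶜ : Finset (Fin n)) : Set (Fin n)) := by
    ext σ; simp [T1set, eq_comm]
  rw [this, Set.ncard_image_of_injective, Set.ncard_coe_finset, Finset.card_compl]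
  · simp
  · intro x y h
    have := congrArg (fun f : Perm (Fin n) => f z) h
    simpa using this

open Equiv in
theorem T1_clique {n : ℕ} (z : Fin n) : IsBClique (T1set n z) := by
  rintro _ ⟨k, hk, rfl⟩ _ ⟨l, hl, rfl⟩ hne
  have hkl : k ≠ l := by rintro rfl; exact hne rfl
  show ((swap k z)⁻¹ * swap l z).IsCycle
  rw [swap_inv, swap_comm k z, swap_comm l z]
  exact (Perm.isThreeCycle_swap_mul_swap_same hk.symm hl.symm hkl).isCycle

/-- Theorem 2.3: for `n ≥ 5`, every clique of transpositions in `G(Ω_n)` has size at most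
`n - 1`; the star `T₁(n)` of transpositions through the last point is a clique of size
`n - 1`; and every clique of transpositions of size `n - 1` is a star of transpositions
through some common point. -/
theorem stmt1 (n : ℕ) (hn : 5 ≤ n) (z : Fin n) (hz : (z : ℕ) = n - 1) :
    (∀ S : Finset (Equiv.Perm (Fin n)), (∀ σ ∈ S, σ.IsSwap) →
      IsBClique (S : Set (Equiv.Perm (Fin n))) → S.card ≤ n - 1) ∧
    (IsBClique (T1set n z) ∧ (T1set n z).ncard = n - 1) ∧
    (∀ S : Finset (Equiv.Perm (Fin n)), (∀ σ ∈ S, σ.IsSwap) →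
      IsBClique (S : Set (Equiv.Perm (Fin n))) → S.card = n - 1 →
      ∃ a : Fin n, (S : Set (Equiv.Perm (Fin n))) = T1set n a) := by
  have fin : ∀ a : Fin n, (T1set n a).Finite := fun a => Set.toFinite _
  refine ⟨fun S hS hc => ?_, ⟨T1_clique z, T1_ncard z⟩, fun S hS hc hcard => ?_⟩
  · by_cases h3 : 3 < S.card
    · obtain ⟨a, ha⟩ := star_aux S hS hc h3
      have := Set.ncard_le_ncard ha (fin a)
      rwa [T1_ncard, Set.ncard_coe_finset] at this
    · omega
  · obtain ⟨a, ha⟩ := star_aux S hS hc (by omega)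
    refine ⟨a, Set.eq_of_subset_of_ncard_le ha ?_ (fin a)⟩
    rw [T1_ncard, Set.ncard_coe_finset, hcard]
end

section
/- Let n ≥ 3 and let A be a clique of the Birkhoff polytope graph G(Ω_n) all of whose elements are 3-cycles of the form (i, j, n) with 1 ≤ i, j ≤ n−1, and suppose A contains no pair of mutually inverse elements (i, j, n) and (j, i, n). Then |A| ≤ ⌊(n−1)²/4⌋. Moreover, if n is odd, equality holds if and only if A is conjugate (by a permutation fixing n) to T_2(n) = {(i, j, n) : 1 ≤ i ≤ ⌊n/2⌋, ⌊n/2⌋+1 ≤ j ≤ n−1}; if n is even, equality holds if and only if A or A⁻¹ = {σ⁻¹ : σ ∈ A} is conjugate (by a permutation fixing n) to T_2(n). -/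
/-- The 3-cycle `(i, j, z)` sending `i ↦ j ↦ z ↦ i` (for `i`, `j`, `z` pairwise distinct). -/
def cyc3 {n : ℕ} (i j z : Fin n) : Equiv.Perm (Fin n) :=
  Equiv.swap i j * Equiv.swap j z

/-- `T₂(n)`: the 3-cycles `(i, j, z)` where (in the paper's 1-based labels)
`1 ≤ i ≤ ⌊n/2⌋` and `⌊n/2⌋ + 1 ≤ j ≤ n - 1`, `z` playing the role of the point `n`. -/
def T2set (n : ℕ) (z : Fin n) : Set (Equiv.Perm (Fin n)) :=
  {σ | ∃ i j : Fin n, (i : ℕ) < n / 2 ∧ n / 2 ≤ (j : ℕ) ∧ (j : ℕ) < n - 1 ∧ σ = cyc3 i j z}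

section Aux
variable {n : ℕ}

lemma cyc3_fst {i j z : Fin n} (hij : i ≠ j) (hiz : i ≠ z) : cyc3 i j z i = j := by
  simp [cyc3, Equiv.swap_apply_of_ne_of_ne hij hiz]

lemma cyc3_snd {i j z : Fin n} (hiz : i ≠ z) (hjz : j ≠ z) : cyc3 i j z j = z := by
  simp [cyc3, Equiv.swap_apply_of_ne_of_ne hiz.symm hjz.symm]

lemma cyc3_thd {i j z : Fin n} : cyc3 i j z z = i := by
  simp [cyc3]

lemma cyc3_other {i j z x : Fin n} (h1 : x ≠ i) (h2 : x ≠ j) (h3 : x ≠ z) :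
    cyc3 i j z x = x := by
  simp [cyc3, Equiv.swap_apply_of_ne_of_ne, h1, h2, h3]

lemma cyc3_inv {i j z : Fin n} (hij : i ≠ j) (hiz : i ≠ z) (hjz : j ≠ z) :
    (cyc3 i j z)⁻¹ = cyc3 j i z := by
  rw [inv_eq_iff_mul_eq_one]
  ext1 x
  rw [Equiv.Perm.mul_apply, Equiv.Perm.one_apply]
  by_cases h1 : x = i
  · subst h1; rw [cyc3_snd hjz hiz, cyc3_thd]
  by_cases h2 : x = j
  · subst h2; rw [cyc3_fst hij.symm hjz, cyc3_fst hij hiz]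
  by_cases h3 : x = z
  · subst h3; rw [cyc3_thd, cyc3_snd hiz hjz]
  rw [cyc3_other h2 h1 h3, cyc3_other h1 h2 h3]

lemma cyc3_conj (π : Equiv.Perm (Fin n)) {i j z : Fin n} (hz : π z = z) :
    π * cyc3 i j z * π⁻¹ = cyc3 (π i) (π j) z := by
  have h : ∀ a b : Fin n, π * Equiv.swap a b = Equiv.swap (π a) (π b) * π :=
    fun a b => Equiv.mul_swap_eq_swap_mul π a b
  unfold cyc3
  rw [← mul_assoc, h, mul_assoc (Equiv.swap (π i) (π j)), h, hz]
  group

lemma path_not_cycle {a v b z : Fin n} (hav : a ≠ v) (haz : a ≠ z) (hvz : v ≠ z)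
    (hvb : v ≠ b) (hbz : b ≠ z) (hba : b ≠ a) :
    ¬ ((cyc3 a v z)⁻¹ * cyc3 v b z).IsCycle := by
  rw [cyc3_inv hav haz hvz]
  intro hc
  have e1 : (cyc3 v a z * cyc3 v b z) v = b := by
    rw [Equiv.Perm.mul_apply, cyc3_fst hvb hvz, cyc3_other hvb.symm hba hbz]
  have e2 : (cyc3 v a z * cyc3 v b z) b = v := by
    rw [Equiv.Perm.mul_apply, cyc3_snd hvz hbz, cyc3_thd]
  have e3 : (cyc3 v a z * cyc3 v b z) a = z := by
    rw [Equiv.Perm.mul_apply, cyc3_other hav hba.symm haz, cyc3_snd hvz haz]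
  obtain ⟨k, hk⟩ := hc.exists_pow_eq (x := v) (y := a) (by rw [e1]; exact hvb.symm)
    (by rw [e3]; exact haz.symm)
  have key : ∀ k : ℕ, ((cyc3 v a z * cyc3 v b z) ^ k) v = v ∨
      ((cyc3 v a z * cyc3 v b z) ^ k) v = b := by
    intro k
    induction k with
    | zero => left; rfl
    | succ k ih =>
      rw [pow_succ', Equiv.Perm.mul_apply]
      rcases ih with h | h
      · right; rw [h, e1]
      · left; rw [h, e2]
  rcases key k with h | h
  · exact hav (hk.symm.trans h)
  · exact hba (h.symm.trans hk)

/-- All the 3-cycles `(i, j, z)` with `i ∈ S`, `j ∈ T`. -/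
def KK (z : Fin n) (S T : Finset (Fin n)) : Finset (Equiv.Perm (Fin n)) :=
  (S ×ˢ T).image (fun p => cyc3 p.1 p.2 z)

lemma mem_KK {z : Fin n} {S T : Finset (Fin n)} {σ : Equiv.Perm (Fin n)} :
    σ ∈ KK z S T ↔ ∃ i ∈ S, ∃ j ∈ T, σ = cyc3 i j z := by
  unfold KK
  simp only [Finset.mem_image, Finset.mem_product, Prod.exists]
  constructor
  · rintro ⟨i, j, ⟨hi, hj⟩, h⟩; exact ⟨i, hi, j, hj, h.symm⟩
  · rintro ⟨i, hi, j, hj, h⟩; exact ⟨i, j, ⟨hi, hj⟩, h.symm⟩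

lemma card_KK {z : Fin n} {S T : Finset (Fin n)} (hd : Disjoint S T) (hS : z ∉ S) (hT : z ∉ T) :
    (KK z S T).card = S.card * T.card := by
  unfold KK
  rw [Finset.card_image_of_injOn, Finset.card_product]
  rintro ⟨i, j⟩ hp ⟨k, l⟩ hq h
  simp only [Finset.coe_product, Set.mem_prod, Finset.mem_coe] at hp hq h
  have hne : ∀ x ∈ S, ∀ y ∈ T, x ≠ y := fun x hx y hy hxy =>
    Finset.disjoint_left.1 hd hx (hxy ▸ hy)
  have hSz : ∀ x ∈ S, x ≠ z := fun x hx hxy => hS (hxy ▸ hx)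
  have h1 : i = k := by
    have := congrArg (fun σ : Equiv.Perm (Fin n) => σ z) h
    simpa only [cyc3_thd] using this
  subst h1
  have := congrArg (fun σ : Equiv.Perm (Fin n) => σ i) h
  simp only [cyc3_fst (hne i hp.1 j hp.2) (hSz i hp.1),
    cyc3_fst (hne i hp.1 l hq.2) (hSz i hp.1)] at this
  rw [this]

lemma KK_inv {z : Fin n} {S T : Finset (Fin n)} (hd : Disjoint S T) (hS : z ∉ S) (hT : z ∉ T) :
    (KK z S T : Set (Equiv.Perm (Fin n)))⁻¹ = KK z T S := by
  have hne : ∀ x ∈ S, ∀ y ∈ T, x ≠ y := fun x hx y hy hxy =>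
    Finset.disjoint_left.1 hd hx (hxy ▸ hy)
  have hSz : ∀ x ∈ S, x ≠ z := fun x hx hxy => hS (hxy ▸ hx)
  have hTz : ∀ x ∈ T, x ≠ z := fun x hx hxy => hT (hxy ▸ hx)
  ext σ
  rw [Set.mem_inv, Finset.mem_coe, Finset.mem_coe, mem_KK, mem_KK]
  constructor
  · rintro ⟨i, hi, j, hj, h⟩
    refine ⟨j, hj, i, hi, ?_⟩
    rw [← cyc3_inv (hne i hi j hj) (hSz i hi) (hTz j hj), ← h, inv_inv]
  · rintro ⟨j, hj, i, hi, h⟩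
    refine ⟨i, hi, j, hj, ?_⟩
    rw [h, cyc3_inv (hne i hi j hj).symm (hTz j hj) (hSz i hi)]

lemma KK_conj {z : Fin n} {S T : Finset (Fin n)} (π : Equiv.Perm (Fin n)) (hπ : π z = z) :
    (fun σ => π * σ * π⁻¹) '' (KK z S T : Set (Equiv.Perm (Fin n))) =
      KK z (S.image π) (T.image π) := by
  ext σ
  rw [Set.mem_image, Finset.mem_coe, mem_KK]
  constructor
  · rintro ⟨τ, hτ, rfl⟩
    rw [Finset.mem_coe, mem_KK] at hτ
    obtain ⟨i, hi, j, hj, rfl⟩ := hτ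
    exact ⟨π i, Finset.mem_image_of_mem _ hi, π j, Finset.mem_image_of_mem _ hj, cyc3_conj π hπ⟩
  · rintro ⟨i, hi, j, hj, rfl⟩
    obtain ⟨i, hi2, rfl⟩ := Finset.mem_image.1 hi
    obtain ⟨j, hj2, rfl⟩ := Finset.mem_image.1 hj
    exact ⟨cyc3 i j z, by rw [Finset.mem_coe, mem_KK]; exact ⟨i, hi2, j, hj2, rfl⟩, cyc3_conj π hπ⟩

/-- The sources in `T₂(n)`. -/
def S0 (n : ℕ) : Finset (Fin n) := Finset.univ.filter (fun i => (i : ℕ) < n / 2)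

/-- The targets in `T₂(n)`. -/
def T0 (n : ℕ) : Finset (Fin n) :=
  Finset.univ.filter (fun i => n / 2 ≤ (i : ℕ) ∧ (i : ℕ) < n - 1)

lemma T2set_eq (z : Fin n) : T2set n z = KK z (S0 n) (T0 n) := by
  ext σ
  rw [Finset.mem_coe, mem_KK]
  simp only [T2set, S0, T0, Set.mem_setOf_eq, Finset.mem_filter, Finset.mem_univ, true_and]
  constructor
  · rintro ⟨i, j, h1, h2, h3, h4⟩; exact ⟨i, h1, j, ⟨h2, h3⟩, h4⟩
  · rintro ⟨i, h1, j, ⟨h2, h3⟩, h4⟩; exact ⟨i, j, h1, h2, h3, h4⟩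

lemma card_S0 : (S0 n).card = n / 2 := by
  rw [← Finset.card_image_of_injective (S0 n) Fin.val_injective]
  have : (S0 n).image Fin.val = Finset.range (n / 2) := by
    ext x
    simp only [S0, Finset.mem_image, Finset.mem_filter, Finset.mem_univ, true_and, Finset.mem_range]
    constructor
    · rintro ⟨a, ha, rfl⟩; exact ha
    · intro h; exact ⟨⟨x, by omega⟩, h, rfl⟩
  rw [this, Finset.card_range]

lemma card_T0 : (T0 n).card = n - 1 - n / 2 := by
  rw [← Finset.card_image_of_injective (T0 n) Fin.val_injective]
  have : (T0 n).image Fin.val = Finset.Ico (n / 2) (n - 1) := by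
    ext x
    simp only [T0, Finset.mem_image, Finset.mem_filter, Finset.mem_univ, true_and, Finset.mem_Ico]
    constructor
    · rintro ⟨a, ha, rfl⟩; exact ha
    · intro h; exact ⟨⟨x, by omega⟩, h, rfl⟩
  rw [this, Nat.card_Ico]

lemma disj0 : Disjoint (S0 n) (T0 n) := by
  rw [Finset.disjoint_left]
  intro a ha hb
  simp only [S0, T0, Finset.mem_filter, Finset.mem_univ, true_and] at ha hb
  omega

lemma z_S0 (hn : 3 ≤ n) {z : Fin n} (hz : (z : ℕ) = n - 1) : z ∉ S0 n := by
  simp only [S0, Finset.mem_filter, Finset.mem_univ, true_and]; omega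

lemma z_T0 {z : Fin n} (hz : (z : ℕ) = n - 1) : z ∉ T0 n := by
  simp only [T0, Finset.mem_filter, Finset.mem_univ, true_and]; omega

lemma exists_perm_of_fibers {α β : Type*} [Fintype α] [DecidableEq α] [DecidableEq β]
    (c d : α → β)
    (h : ∀ b, (Finset.univ.filter (fun a => c a = b)).card =
      (Finset.univ.filter (fun a => d a = b)).card) :
    ∃ π : Equiv.Perm α, ∀ a, d (π a) = c a := by
  have e : ∀ b, Nonempty ({a // c a = b} ≃ {a // d a = b}) := by
    intro b
    apply Fintype.card_eq.1
    rw [Fintype.card_subtype, Fintype.card_subtype, h b]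
  refine ⟨((Equiv.sigmaFiberEquiv c).symm.trans (Equiv.sigmaCongrRight fun b => (e b).some)).trans
    (Equiv.sigmaFiberEquiv d), fun a => ?_⟩
  exact ((e (c a)).some ⟨a, rfl⟩).2

lemma exists_perm {z : Fin n} {S T S' T' : Finset (Fin n)} (hd : Disjoint S T) (hS : z ∉ S)
    (hT : z ∉ T) (hd' : Disjoint S' T') (hS' : z ∉ S') (hT' : z ∉ T')
    (h1 : S.card = S'.card) (h2 : T.card = T'.card) (hc : S.card + T.card = n - 1) :
    ∃ π : Equiv.Perm (Fin n), π z = z ∧ S.image π = S' ∧ T.image π = T' := by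
  have full : ∀ {S T : Finset (Fin n)}, Disjoint S T → z ∉ S → z ∉ T →
      S.card + T.card = n - 1 → ∀ x, x ∉ S → x ∉ T → x = z := by
    intro S T hd hS hT hc x hxS hxT
    by_contra hne
    have hcard : (insert x (insert z (S ∪ T))).card = n - 1 + 2 := by
      rw [Finset.card_insert_of_notMem, Finset.card_insert_of_notMem,
        Finset.card_union_of_disjoint hd, hc]
      · simp [hS, hT]
      · simp [hxS, hxT, hne]
    have := Finset.card_le_univ (insert x (insert z (S ∪ T)))
    rw [hcard, Fintype.card_fin] at this
    omega
  have f1 := full hd hS hT hc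
  have f2 := full hd' hS' hT' (by omega)
  let col : Finset (Fin n) → Finset (Fin n) → Fin n → Fin 3 :=
    fun S T x => if x ∈ S then 0 else if x ∈ T then 1 else 2
  have c0 : ∀ (S T : Finset (Fin n)) x, col S T x = 0 ↔ x ∈ S := by
    intro S T x; simp only [col]; split_ifs <;> simp_all
  have c1 : ∀ {S T : Finset (Fin n)}, Disjoint S T → ∀ x, (col S T x = 1 ↔ x ∈ T) := by
    intro S T hd x
    have := @Finset.disjoint_left _ S T
    simp only [col]; split_ifs <;> simp_all
  have c2 : ∀ (S T : Finset (Fin n)) x, col S T x = 2 ↔ (x ∉ S ∧ x ∉ T) := by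
    intro S T x; simp only [col]; split_ifs <;> simp_all
  obtain ⟨π, hπ⟩ := exists_perm_of_fibers (col S T) (col S' T') (by
    intro b
    fin_cases b
    · simpa [c0] using h1
    · simpa [c1 hd, c1 hd'] using h2
    · have g1 : (Finset.univ.filter fun x => x ∉ S ∧ x ∉ T) = {z} := by
        ext x; simp only [Finset.mem_filter, Finset.mem_univ, true_and, Finset.mem_singleton]
        exact ⟨fun h => f1 x h.1 h.2, fun h => h ▸ ⟨hS, hT⟩⟩
      have g2 : (Finset.univ.filter fun x => x ∉ S' ∧ x ∉ T') = {z} := by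
        ext x; simp only [Finset.mem_filter, Finset.mem_univ, true_and, Finset.mem_singleton]
        exact ⟨fun h => f2 x h.1 h.2, fun h => h ▸ ⟨hS', hT'⟩⟩
      simp only [Fin.reduceFinMk, c2, g1, g2])
  refine ⟨π, ?_, ?_, ?_⟩
  · have := (c2 S' T' (π z)).1 (by rw [hπ, c2]; exact ⟨hS, hT⟩)
    exact f2 _ this.1 this.2
  · apply Finset.eq_of_subset_of_card_le
    · intro x hx
      obtain ⟨y, hy, rfl⟩ := Finset.mem_image.1 hx
      rw [← c0 S' T', hπ, c0]; exact hy
    · rw [Finset.card_image_of_injective _ π.injective, h1]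
  · apply Finset.eq_of_subset_of_card_le
    · intro x hx
      obtain ⟨y, hy, rfl⟩ := Finset.mem_image.1 hx
      rw [← c1 hd', hπ, c1 hd]; exact hy
    · rw [Finset.card_image_of_injective _ π.injective, h2]

lemma arith_le {s t m : ℕ} (h : s + t ≤ m) : s * t ≤ m ^ 2 / 4 := by
  rw [Nat.le_div_iff_mul_le (by norm_num)]
  have : (s + t) ^ 2 ≤ m ^ 2 := Nat.pow_le_pow_left h 2
  have h4 : s * t * 4 ≤ (s + t) ^ 2 := by
    zify; nlinarith [sq_nonneg ((s : ℤ) - t)]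
  omega

lemma arith_half (n : ℕ) (hn : 3 ≤ n) : (n / 2) * (n - 1 - n / 2) = (n - 1) ^ 2 / 4 := by
  obtain ⟨k, hk | hk⟩ := Nat.even_or_odd' n
  · obtain ⟨l, rfl⟩ : ∃ l, k = l + 1 := ⟨k - 1, by omega⟩
    have e1 : n / 2 = l + 1 := by omega
    have e2 : n - 1 = 2 * l + 1 := by omega
    have e3 : 2 * l + 1 - (l + 1) = l := by omega
    rw [e1, e2, e3]
    have : (2 * l + 1) ^ 2 = 4 * ((l + 1) * l) + 1 := by ring
    omega
  · have e1 : n / 2 = k := by omega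
    have e2 : n - 1 = 2 * k := by omega
    have e3 : 2 * k - k = k := by omega
    rw [e1, e2, e3]
    have : (2 * k) ^ 2 = 4 * (k * k) := by ring
    omega

lemma arith_eq {s t n : ℕ} (hn : 3 ≤ n) (h : s + t ≤ n - 1) (he : (n - 1) ^ 2 / 4 ≤ s * t) :
    s + t = n - 1 ∧ ((s = n / 2 ∧ t = n - 1 - n / 2) ∨ (t = n / 2 ∧ s = n - 1 - n / 2)) := by
  obtain ⟨m, rfl⟩ : ∃ m, n = m + 1 := ⟨n - 1, by omega⟩
  simp only [Nat.add_sub_cancel] at *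
  have hlt : m ^ 2 < 4 * (s * t) + 4 := by omega
  have hsum : s + t = m := by
    by_contra hne
    have h1 : s + t + 1 ≤ m := by omega
    have h2 : (s + t + 1) ^ 2 ≤ m ^ 2 := Nat.pow_le_pow_left h1 2
    have h3 : 4 * (s * t) ≤ (s + t) ^ 2 := by zify; nlinarith [sq_nonneg ((s : ℤ) - t)]
    have h4 : (s + t + 1) ^ 2 = (s + t) ^ 2 + 2 * (s + t) + 1 := by ring
    have h5 : s + t ≤ 1 := by omega
    have h6 : s * t = 0 := by
      rcases Nat.eq_zero_or_pos s with h | h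
      · simp [h]
      · have : t = 0 := by omega
        simp [this]
    rw [h6] at hlt
    have : 2 ^ 2 ≤ m ^ 2 := Nat.pow_le_pow_left (by omega) 2
    omega
  refine ⟨hsum, ?_⟩
  subst hsum
  have h1 : s < t + 2 := by
    by_contra hh
    obtain ⟨d, rfl⟩ : ∃ d, s = t + 2 + d := ⟨s - t - 2, by omega⟩
    nlinarith
  have h2 : t < s + 2 := by
    by_contra hh
    obtain ⟨d, rfl⟩ : ∃ d, t = s + 2 + d := ⟨t - s - 2, by omega⟩
    nlinarith
  omega

end Aux

/-- Lemma 2.6: if `A` is a clique of `G(Ω_n)` consisting of 3-cycles `(i, j, n)` (the point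
`n` being `z`), containing no pair of mutually inverse elements, then
`|A| ≤ ⌊(n-1)²/4⌋`, with equality (for odd `n`) iff `A` is conjugate, by a permutation
fixing `z`, to `T₂(n)`, and (for even `n`) iff `A` or `A⁻¹` is so conjugate. -/
theorem stmt2 (n : ℕ) (hn : 3 ≤ n) (z : Fin n) (hz : (z : ℕ) = n - 1)
    (A : Finset (Equiv.Perm (Fin n)))
    (hform : ∀ σ ∈ A, ∃ i j : Fin n, i ≠ j ∧ i ≠ z ∧ j ≠ z ∧ σ = cyc3 i j z)
    (hclique : IsBClique (A : Set (Equiv.Perm (Fin n))))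
    (hnoinv : ∀ σ ∈ A, σ⁻¹ ∉ A) :
    A.card ≤ (n - 1) ^ 2 / 4 ∧
    (Odd n → (A.card = (n - 1) ^ 2 / 4 ↔
      ∃ π : Equiv.Perm (Fin n), π z = z ∧
        (A : Set (Equiv.Perm (Fin n))) = (fun σ => π * σ * π⁻¹) '' T2set n z)) ∧
    (Even n → (A.card = (n - 1) ^ 2 / 4 ↔
      ∃ π : Equiv.Perm (Fin n), π z = z ∧
        ((A : Set (Equiv.Perm (Fin n))) = (fun σ => π * σ * π⁻¹) '' T2set n z ∨
         (A : Set (Equiv.Perm (Fin n)))⁻¹ = (fun σ => π * σ * π⁻¹) '' T2set n z))) := by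
  classical
  let S : Finset (Fin n) := A.image (fun σ => σ z)
  let T : Finset (Fin n) := A.image (fun σ => σ⁻¹ z)
  have hS : z ∉ S := by
    intro h
    obtain ⟨σ, hσ, h⟩ := Finset.mem_image.1 h
    obtain ⟨i, j, hij, hi, hj, rfl⟩ := hform σ hσ
    rw [cyc3_thd] at h
    exact hi h
  have hT : z ∉ T := by
    intro h
    obtain ⟨σ, hσ, h⟩ := Finset.mem_image.1 h
    obtain ⟨i, j, hij, hi, hj, rfl⟩ := hform σ hσ
    rw [cyc3_inv hij hi hj, cyc3_thd] at h
    exact hj h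
  have hd : Disjoint S T := by
    rw [Finset.disjoint_left]
    intro v hvS hvT
    obtain ⟨τ, hτ, h1⟩ := Finset.mem_image.1 hvS
    obtain ⟨σ, hσ, h2⟩ := Finset.mem_image.1 hvT
    obtain ⟨a, j, haj, ha, hj, rfl⟩ := hform σ hσ
    obtain ⟨i, b, hib, hi, hb, rfl⟩ := hform τ hτ
    rw [cyc3_inv haj ha hj, cyc3_thd] at h2
    rw [cyc3_thd] at h1
    subst h1
    subst h2
    by_cases hba : b = a
    · subst hba
      apply hnoinv _ hσ
      rw [cyc3_inv haj ha hj]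
      exact hτ
    · refine path_not_cycle haj ha hj hib hb hba (hclique hσ hτ ?_)
      intro h
      have := congrArg (fun σ : Equiv.Perm (Fin n) => σ j) h
      simp only [cyc3_snd ha hj, cyc3_fst hib hi] at this
      exact hb this.symm
  have hsub : A ⊆ KK z S T := by
    intro σ hσ
    obtain ⟨i, j, hij, hi, hj, rfl⟩ := hform σ hσ
    rw [mem_KK]
    refine ⟨i, Finset.mem_image.2 ⟨_, hσ, cyc3_thd⟩, j, Finset.mem_image.2 ⟨_, hσ, ?_⟩, rfl⟩
    rw [cyc3_inv hij hi hj, cyc3_thd]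
  have hsum : S.card + T.card ≤ n - 1 := by
    have hcard : (insert z (S ∪ T)).card = S.card + T.card + 1 := by
      rw [Finset.card_insert_of_notMem, Finset.card_union_of_disjoint hd]
      simp [hS, hT]
    have := Finset.card_le_univ (insert z (S ∪ T))
    rw [hcard, Fintype.card_fin] at this
    omega
  have hle : A.card ≤ S.card * T.card := by
    rw [← card_KK hd hS hT]; exact Finset.card_le_card hsub
  have hconv : ∀ (B : Finset (Equiv.Perm (Fin n))) (π : Equiv.Perm (Fin n)), π z = z →
      (B : Set (Equiv.Perm (Fin n))) = (fun σ => π * σ * π⁻¹) '' T2set n z →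
      B.card = (n - 1) ^ 2 / 4 := by
    intro B π hπ h
    rw [T2set_eq, ← Finset.coe_image, Finset.coe_inj] at h
    rw [h, Finset.card_image_of_injective, card_KK disj0 (z_S0 hn hz) (z_T0 hz), card_S0, card_T0,
      arith_half n hn]
    intro σ τ h
    simpa using h
  have hfwd : A.card = (n - 1) ^ 2 / 4 → A = KK z S T ∧
      ((S.card = n / 2 ∧ T.card = n - 1 - n / 2) ∨
        (T.card = n / 2 ∧ S.card = n - 1 - n / 2)) := by
    intro h
    refine ⟨Finset.eq_of_subset_of_card_le hsub ?_, (arith_eq hn hsum (h ▸ hle)).2⟩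
    rw [card_KK hd hS hT, h]
    exact arith_le hsum
  have hc0 : (S0 n).card + (T0 n).card = n - 1 := by rw [card_S0, card_T0]; omega
  have hex : ∀ S T : Finset (Fin n), Disjoint S T → z ∉ S → z ∉ T → S.card = n / 2 →
      T.card = n - 1 - n / 2 → ∃ π : Equiv.Perm (Fin n), π z = z ∧
        (KK z S T : Set (Equiv.Perm (Fin n))) = (fun σ => π * σ * π⁻¹) '' T2set n z := by
    intro S T hd hS hT h1 h2
    obtain ⟨π, hπ, e1, e2⟩ := exists_perm disj0 (z_S0 hn hz) (z_T0 hz) hd hS hT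
      (by rw [card_S0, h1]) (by rw [card_T0, h2]) hc0
    exact ⟨π, hπ, by rw [T2set_eq, KK_conj π hπ, e1, e2]⟩
  refine ⟨hle.trans (arith_le hsum), ?_, ?_⟩
  · rintro ⟨k, hk⟩
    constructor
    · intro h
      obtain ⟨hA, hc⟩ := hfwd h
      rw [hA]
      exact hex S T hd hS hT (by omega) (by omega)
    · rintro ⟨π, hπ, h⟩
      exact hconv A π hπ h
  · intro _
    constructor
    · intro h
      obtain ⟨hA, hc | hc⟩ := hfwd h
      · obtain ⟨π, hπ, h⟩ := hex S T hd hS hT hc.1 hc.2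
        exact ⟨π, hπ, Or.inl (by rw [hA]; exact h)⟩
      · obtain ⟨π, hπ, h⟩ := hex T S hd.symm hT hS hc.1 hc.2
        exact ⟨π, hπ, Or.inr (by rw [hA, KK_inv hd hS hT]; exact h)⟩
    · rintro ⟨π, hπ, h | h⟩
      · exact hconv A π hπ h
      · have := hconv (A.image (fun σ => σ⁻¹)) π hπ (by
          rw [← h, Finset.coe_image, Set.image_inv_eq_inv])
        rwa [Finset.card_image_of_injective _ inv_injective] at this
end

section
/- Let n ≥ 10. Then the set {id} ∪ T_1(n) ∪ T_2(n), where T_1(n) = {(k, n) : 1 ≤ k ≤ n−1} and T_2(n) = {(i, j, n) : 1 ≤ i ≤ ⌊n/2⌋, ⌊n/2⌋+1 ≤ j ≤ n−1}, is a maximal clique of the Birkhoff polytope graph G(Ω_n): it is a clique, and for every permutation σ not in this set, adjoining σ does not yield a clique. -/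
open Equiv Equiv.Perm in
lemma cyc_of_list {n : ℕ} (g h : Perm (Fin n)) (l : List (Fin n)) (hl : l.Nodup)
    (h2 : 2 ≤ l.length) (e : ∀ x, h x = g (l.formPerm x)) : (g⁻¹ * h).IsCycle := by
  have : g⁻¹ * h = l.formPerm := by
    ext x; simp [e]
  rw [this]
  exact List.isCycle_formPerm hl h2

open Equiv Equiv.Perm in
lemma cyc_symm {n : ℕ} {g h : Perm (Fin n)} (H : (g⁻¹ * h).IsCycle) : (h⁻¹ * g).IsCycle := by
  have := H.inv
  simpa using this

open Equiv Equiv.Perm in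
lemma cyc_T1T1 {n : ℕ} (k l z : Fin n) (hk : k ≠ z) (hl : l ≠ z) (h : k ≠ l) :
    ((swap k z)⁻¹ * swap l z).IsCycle := by
  apply cyc_of_list _ _ [l, k, z]
  · grind
  · simp
  · intro x
    simp only [List.formPerm_cons_cons, List.formPerm_singleton, Perm.mul_apply, mul_one,
      swap_apply_def]
    grind

open Equiv Equiv.Perm in
lemma cyc_oneT2 {n : ℕ} (i j z : Fin n) (hi : i ≠ z) (hj : j ≠ z) (h : i ≠ j) :
    ((1 : Perm (Fin n))⁻¹ * cyc3 i j z).IsCycle := by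
  apply cyc_of_list _ _ [i, j, z]
  · grind
  · simp
  · intro x
    simp only [List.formPerm_cons_cons, List.formPerm_singleton, Perm.mul_apply, mul_one,
      swap_apply_def, cyc3, Perm.one_apply]

open Equiv Equiv.Perm in
lemma cyc_T1T2 {n : ℕ} (k i j z : Fin n) (hk : k ≠ z) (hi : i ≠ z) (hj : j ≠ z) (h : i ≠ j) :
    ((swap k z)⁻¹ * cyc3 i j z).IsCycle := by
  by_cases h1 : k = i
  · apply cyc_of_list _ _ [i, j]
    · grind
    · simp
    · intro x
      simp only [List.formPerm_cons_cons, List.formPerm_singleton, Perm.mul_apply, mul_one,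
        swap_apply_def, cyc3]
      grind
  by_cases h2 : k = j
  · apply cyc_of_list _ _ [i, z]
    · grind
    · simp
    · intro x
      simp only [List.formPerm_cons_cons, List.formPerm_singleton, Perm.mul_apply, mul_one,
        swap_apply_def, cyc3]
      grind
  apply cyc_of_list _ _ [i, j, k, z]
  · grind
  · simp
  · intro x
    simp only [List.formPerm_cons_cons, List.formPerm_singleton, Perm.mul_apply, mul_one,
        swap_apply_def, cyc3]
    grind

open Equiv Equiv.Perm in
lemma cyc_T2T2 {n : ℕ} (a b i j z : Fin n) (ha : a ≠ z) (hb : b ≠ z) (hi : i ≠ z) (hj : j ≠ z)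
    (h : i ≠ j) (h' : a ≠ b) (haj : a ≠ j) (hib : i ≠ b) (hne : ¬ (a = i ∧ b = j)) :
    ((cyc3 a b z)⁻¹ * cyc3 i j z).IsCycle := by
  by_cases h1 : a = i
  · apply cyc_of_list _ _ [i, j, b]
    · grind
    · simp
    · intro x
      simp only [List.formPerm_cons_cons, List.formPerm_singleton, Perm.mul_apply, mul_one,
        swap_apply_def, cyc3]
      grind
  by_cases h2 : b = j
  · apply cyc_of_list _ _ [i, a, z]
    · grind
    · simp
    · intro x
      simp only [List.formPerm_cons_cons, List.formPerm_singleton, Perm.mul_apply, mul_one,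
        swap_apply_def, cyc3]
      grind
  apply cyc_of_list _ _ [z, i, j, b, a]
  · grind
  · simp
  · intro x
    simp only [List.formPerm_cons_cons, List.formPerm_singleton, Perm.mul_apply, mul_one,
        swap_apply_def, cyc3]
    grind

open Equiv Equiv.Perm in
lemma clique_part (n : ℕ) (z : Fin n) (hz : (z : ℕ) = n - 1) :
    IsBClique ({1} ∪ T1set n z ∪ T2set n z) := by
  rintro σ ((rfl | ⟨k, hk, rfl⟩) | ⟨i, j, hi, hj, hj', rfl⟩) τ
    ((rfl | ⟨l, hl, rfl⟩) | ⟨a, b, ha, hb, hb', rfl⟩) hne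
  · exact absurd rfl hne
  · simpa using isCycle_swap hl
  · apply cyc_oneT2 <;> grind
  · apply cyc_symm; simpa using isCycle_swap hk
  · apply cyc_T1T1 <;> grind
  · apply cyc_T1T2 <;> grind
  · apply cyc_symm; apply cyc_oneT2 <;> grind
  · apply cyc_symm; apply cyc_T1T2 <;> grind
  · apply cyc_T2T2 <;> grind

open Equiv Equiv.Perm in
lemma sign_contra {n : ℕ} {f g : Perm (Fin n)} (hf : f.IsCycle) (hg : g.IsCycle)
    (hs : sign f * (-1) ^ f.support.card ≠ sign g * (-1) ^ g.support.card) : False := by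
  apply hs
  rw [hf.sign, hg.sign]
  simp [← mul_pow]

open Equiv Equiv.Perm in
/-- Two disjoint transposition-like orbits prevent being a cycle. -/
lemma not_cycle_two {n : ℕ} {f : Perm (Fin n)} (hf : f.IsCycle) (x y : Fin n)
    (hx : f x ≠ x) (hxx : f (f x) = x) (hy : f y ≠ y) (h1 : y ≠ x) (h2 : y ≠ f x) : False := by
  have := hf.eq_swap_of_apply_apply_eq_self hx hxx
  apply hy
  rw [this]
  exact swap_apply_of_ne_of_ne h1 h2

open Equiv Equiv.Perm in
theorem max_part (n : ℕ) (hn : 10 ≤ n) (z : Fin n) (hz : (z : ℕ) = n - 1)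
    (ρ : Perm (Fin n)) (h1 : ρ.IsCycle)
    (hT1 : ∀ k, k ≠ z → ρ ≠ swap k z → (ρ * swap k z).IsCycle)
    (hT2 : ∀ i j : Fin n, (i : ℕ) < n / 2 → n / 2 ≤ (j : ℕ) → (j : ℕ) < n - 1 →
      ρ ≠ (cyc3 i j z)⁻¹ → (ρ * cyc3 i j z).IsCycle)
    (hn1 : ∀ k, k ≠ z → ρ ≠ swap k z)
    (hn2 : ∀ i j : Fin n, (i : ℕ) < n / 2 → n / 2 ≤ (j : ℕ) → (j : ℕ) < n - 1 →
      ρ ≠ (cyc3 i j z)⁻¹) : False := by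
  have hT1' : ∀ k, k ≠ z → (ρ * swap k z).IsCycle := fun k hk => hT1 k hk (hn1 k hk)
  have hT2' : ∀ i j : Fin n, (i : ℕ) < n / 2 → n / 2 ≤ (j : ℕ) → (j : ℕ) < n - 1 →
      (ρ * cyc3 i j z).IsCycle := fun i j a b c => hT2 i j a b c (hn2 i j a b c)
  clear hT1 hT2
  by_cases hz0 : ρ z = z
  · by_cases hk : ∃ k, k ≠ z ∧ ρ k = k
    · obtain ⟨k, hkz, hk⟩ := hk
      refine not_cycle_two (hT1' k hkz) z (Classical.choose h1) ?_ ?_ ?_ ?_ ?_ <;>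
      have h3 := (Classical.choose_spec h1).1 <;>
      generalize Classical.choose h1 = w at * <;>
      (try simp only [Perm.mul_apply, swap_apply_def]) <;> grind
    · push Not at hk
      obtain ⟨i, j, hi, hj, hj', hij⟩ : ∃ i j : Fin n, (i : ℕ) < n / 2 ∧ n / 2 ≤ (j : ℕ) ∧
          (j : ℕ) < n - 1 ∧ ρ j ≠ i := by
        by_cases h : ρ ⟨n / 2, by omega⟩ = ⟨0, by omega⟩
        · refine ⟨⟨1, by omega⟩, ⟨n / 2, by omega⟩, ?_, ?_, ?_, ?_⟩ <;> simp [h] <;> omega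
        · refine ⟨⟨0, by omega⟩, ⟨n / 2, by omega⟩, ?_, ?_, ?_, h⟩ <;> simp <;> omega
      have hiz : i ≠ z := by grind
      have hjz : j ≠ z := by grind
      have hne : i ≠ j := by grind
      have hs1 : ρ.support = Finset.univ.erase z := by
        ext x; simp only [mem_support, Finset.mem_erase, Finset.mem_univ, and_true]; grind
      have hs2 : (ρ * cyc3 i j z).support = Finset.univ := by
        ext x
        have := ρ.injective
        simp only [mem_support, Finset.mem_univ, iff_true, cyc3, Perm.mul_apply, swap_apply_def]
        grind
      refine sign_contra h1 (hT2' i j hi hj hj') ?_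
      rw [hs1, hs2, Finset.card_erase_of_mem (Finset.mem_univ _), Finset.card_univ,
        Fintype.card_fin]
      obtain ⟨m, rfl⟩ : ∃ m, n = m + 1 := ⟨n - 1, by omega⟩
      simp [cyc3, sign_swap hne, sign_swap hjz, pow_succ]
  · have key : ∀ k, ρ k ≠ k → k ≠ z → k ≠ ρ z → ρ k = z := by
      intro k hk hkz hkz'
      by_contra hkz2
      refine sign_contra h1 (hT1' k hkz) ?_
      have : (ρ * swap k z).support = ρ.support := by
        ext x
        simp only [mem_support, Perm.mul_apply, swap_apply_def]
        grind
      rw [this]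
      simp [sign_swap hkz]
    have hinj := ρ.injective
    by_cases hzz : ρ (ρ z) = z
    · refine hn1 (ρ z) hz0 ?_
      rw [swap_comm]
      exact h1.eq_swap_of_apply_apply_eq_self hz0 hzz
    -- `ρ : z ↦ b ↦ a ↦ z`
    obtain ⟨b, hb⟩ : ∃ b, b = ρ z := ⟨_, rfl⟩
    obtain ⟨a, ha⟩ : ∃ a, a = ρ b := ⟨_, rfl⟩
    have hab : a ≠ b := by grind
    have haz : a ≠ z := by grind
    have hbz : b ≠ z := by grind
    have hra : ρ a = z := key a (by grind) haz (by grind)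
    have hρ : ρ = (cyc3 a b z)⁻¹ := by
      rw [eq_inv_iff_mul_eq_one]
      ext x
      congr 1
      have := key x
      simp only [cyc3, Perm.mul_apply, swap_apply_def, Perm.one_apply]
      grind
    by_cases hbA : (b : ℕ) < n / 2
    · obtain ⟨j, hj, hj', hja⟩ : ∃ j : Fin n, n / 2 ≤ (j : ℕ) ∧ (j : ℕ) < n - 1 ∧ j ≠ a := by
        by_cases h : a = ⟨n / 2, by omega⟩
        · refine ⟨⟨n / 2 + 1, by omega⟩, ?_, ?_, ?_⟩ <;> simp [h] <;> omega
        · refine ⟨⟨n / 2, by omega⟩, ?_, ?_, Ne.symm h⟩ <;> simp <;> omega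
      have := hT2' b j hbA hj hj'
      refine not_cycle_two this z b ?_ ?_ ?_ ?_ ?_ <;>
      (try simp only [cyc3, Perm.mul_apply, swap_apply_def]) <;> grind
    · by_cases haA : (a : ℕ) < n / 2
      · exact hn2 a b haA (by omega) (by grind) hρ
      · have := hT2' ⟨0, by omega⟩ a (by simp; omega) (by omega) (by grind)
        have h0 : (⟨0, by omega⟩ : Fin n) ≠ a := by grind
        have h0' : (⟨0, by omega⟩ : Fin n) ≠ b := by grind
        have h0z : (⟨0, by omega⟩ : Fin n) ≠ z := by grind
        generalize (⟨0, by omega⟩ : Fin n) = i at *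
        refine not_cycle_two this a z ?_ ?_ ?_ ?_ ?_ <;>
        (try simp only [cyc3, Perm.mul_apply, swap_apply_def]) <;> grind

theorem stmt4 (n : ℕ) (hn : 10 ≤ n) (z : Fin n) (hz : (z : ℕ) = n - 1) :
    IsBClique ({1} ∪ T1set n z ∪ T2set n z) ∧
    ∀ σ : Equiv.Perm (Fin n), σ ∉ ({1} ∪ T1set n z ∪ T2set n z : Set (Equiv.Perm (Fin n))) →
      ¬ IsBClique (insert σ ({1} ∪ T1set n z ∪ T2set n z)) := by
  refine ⟨clique_part n z hz, fun σ hσ hc => ?_⟩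
  have H : ∀ τ ∈ ({1} ∪ T1set n z ∪ T2set n z : Set (Equiv.Perm (Fin n))),
      (σ⁻¹ * τ).IsCycle := by
    intro τ hτ
    refine hc (Set.mem_insert _ _) (Set.mem_insert_of_mem _ hτ) ?_
    rintro rfl
    exact hσ hτ
  refine max_part n hn z hz σ⁻¹ ?_ ?_ ?_ ?_ ?_
  · simpa using H 1 (Or.inl (Or.inl rfl))
  · intro k hk _
    exact H _ (Or.inl (Or.inr ⟨k, hk, rfl⟩))
  · intro i j hi hj hj' _
    exact H _ (Or.inr ⟨i, j, hi, hj, hj', rfl⟩)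
  · intro k hk h
    refine hσ (Or.inl (Or.inr ⟨k, hk, ?_⟩))
    rw [← inv_inv σ, h, Equiv.swap_inv]
  · intro i j hi hj hj' h
    exact hσ (Or.inr ⟨i, j, hi, hj, hj', inv_injective h⟩)
end

section
/- Let n ≥ 10 and let ω(n) denote the clique number of the Birkhoff polytope graph G(Ω_n). If n is even then ω(n) ≥ (n² + 2n)/4, and if n is odd then ω(n) ≥ (n + 1)²/4. -/
/-- The clique number `ω(n)` of the Birkhoff polytope graph `G(Ω_n)`. -/
noncomputable def birkhoffCliqueNum (n : ℕ) : ℕ :=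
  sSup {k | ∃ S : Finset (Equiv.Perm (Fin n)),
    IsBClique (S : Set (Equiv.Perm (Fin n))) ∧ S.card = k}

open Equiv Equiv.Perm

lemma starProd_formPerm {α : Type*} [DecidableEq α] (x : α) (l : List α) (hl : l.Nodup)
    (hx : x ∉ l) : ∃ l' : List α, l'.Perm l ∧
      (l.map (swap x)).prod = (x :: l').formPerm := by
  induction l with
  | nil => exact ⟨[], List.Perm.refl _, by simp⟩
  | cons d l ih =>
    simp only [List.nodup_cons, List.mem_cons, not_or] at hl hx
    obtain ⟨l', hp, he⟩ := ih hl.2 hx.2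
    refine ⟨l' ++ [d], ?_, ?_⟩
    · exact (List.perm_append_singleton d l').trans (hp.cons d)
    · have hnd : (d :: x :: l').Nodup := by
        simp only [List.nodup_cons, List.mem_cons, not_or, hp.mem_iff, hp.nodup_iff]
        exact ⟨⟨fun h => hx.1 h.symm, hl.1⟩, hx.2, hl.2⟩
      have h1 := List.formPerm_rotate_one (d :: x :: l') hnd
      have h2 : (d :: x :: l').rotate 1 = x :: (l' ++ [d]) := by simp
      rw [h2] at h1
      rw [h1, List.formPerm_cons_cons, List.map_cons, List.prod_cons, he, swap_comm]

lemma starProd_isCycle {α : Type*} [DecidableEq α] (x : α) (l : List α) (hl : l.Nodup)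
    (hx : x ∉ l) (h0 : l ≠ []) : ((l.map (swap x)).prod).IsCycle := by
  obtain ⟨l', hp, he⟩ := starProd_formPerm x l hl hx
  rw [he]
  apply List.isCycle_formPerm
  · simp only [List.nodup_cons, hp.mem_iff, hp.nodup_iff]
    exact ⟨hx, hl⟩
  · have := hp.length_eq
    have := List.length_pos_iff.2 h0
    simp only [List.length_cons]
    omega

lemma starProd_filter {α : Type*} [DecidableEq α] (x : α) (l : List α) :
    (l.map (swap x)).prod = ((l.filter (· ≠ x)).map (swap x)).prod := by
  induction l with
  | nil => simp
  | cons d l ih =>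
    by_cases h : d = x
    · subst h
      rw [List.map_cons, List.prod_cons, swap_self, ← Perm.one_def, one_mul, ih]
      simp
    · simp only [List.map_cons, List.prod_cons, ih]
      rw [List.filter_cons_of_pos (by simpa using h)]
      simp

lemma starProd_isCycle' {α : Type*} [DecidableEq α] (x : α) (l : List α)
    (hl : (l.filter (· ≠ x)).Nodup) (h0 : l.filter (· ≠ x) ≠ []) :
    ((l.map (swap x)).prod).IsCycle := by
  rw [starProd_filter]
  exact starProd_isCycle x _ hl (by simp) h0

lemma quot_isCycle {α : Type*} [DecidableEq α] (x a b c d : α)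
    (hab : a = b → a = x) (had : a = d → a = x) (hcb : c = b → c = x) (hcd : c = d → c = x)
    (hne : ¬ (a = c ∧ b = d)) :
    ((swap x a * swap x b)⁻¹ * (swap x c * swap x d)).IsCycle := by
  have two : ∀ p q : α, p ≠ q → (swap x p * swap x q).IsCycle := by
    intro p q hpq
    have := starProd_isCycle' x [p, q]
      (by by_cases h1 : p = x <;> by_cases h2 : q = x <;> simp_all)
      (by by_cases h1 : p = x <;> by_cases h2 : q = x <;> simp_all)
    simpa using this
  have hconj : (swap x d * swap x b * (swap x a * swap x c)).IsCycle →
      ((swap x a * swap x b)⁻¹ * (swap x c * swap x d)).IsCycle := by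
    intro h
    have := h.conj (g := swap x d)
    convert this using 1
    simp [mul_assoc]
  apply hconj
  by_cases h1 : a = c
  · subst h1
    have : b ≠ d := fun h => hne ⟨rfl, h⟩
    simpa using two d b this.symm
  by_cases h2 : b = d
  · subst h2
    simpa using two a c h1
  have := starProd_isCycle' x [d, b, a, c]
      (by
        by_cases e1 : a = x <;> by_cases e2 : b = x <;> by_cases e3 : c = x <;>
          by_cases e4 : d = x <;> simp_all <;> grind)
      (by
        by_cases e1 : a = x <;> by_cases e2 : b = x <;> by_cases e3 : c = x <;>
          by_cases e4 : d = x <;> simp_all)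
  simpa [mul_assoc] using this

lemma clique_bound (n k : ℕ) (hk : k < n) : (k + 1) * (n - k) ≤ birkhoffCliqueNum n := by
  let x : Fin n := ⟨k, hk⟩
  let f : Fin n × Fin n → Perm (Fin n) := fun p => swap x p.1 * swap x p.2
  let T : Finset (Fin n × Fin n) := Finset.Iic x ×ˢ Finset.Ici x
  have key : ∀ p ∈ T, ∀ q ∈ T, p ≠ q → ((f p)⁻¹ * f q).IsCycle := by
    rintro ⟨a, b⟩ hp ⟨c, d⟩ hq hne
    simp only [T, Finset.mem_product, Finset.mem_Iic, Finset.mem_Ici] at hp hq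
    change ((swap x a * swap x b)⁻¹ * (swap x c * swap x d)).IsCycle
    apply quot_isCycle
    · rintro rfl; exact le_antisymm hp.1 hp.2
    · rintro rfl; exact le_antisymm hp.1 hq.2
    · rintro rfl; exact le_antisymm hq.1 hp.2
    · rintro rfl; exact le_antisymm hq.1 hq.2
    · rintro ⟨rfl, rfl⟩; exact hne rfl
  have hinj : Set.InjOn f (T : Set (Fin n × Fin n)) := by
    intro p hp q hq h
    by_contra hne
    have := key p hp q hq hne
    rw [h, inv_mul_cancel] at this
    exact this.ne_one rfl
  apply le_csSup
  · refine ⟨Fintype.card (Perm (Fin n)), ?_⟩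
    rintro m ⟨S, -, rfl⟩
    exact Finset.card_le_univ S
  · refine ⟨T.image f, ?_, ?_⟩
    · intro σ hσ τ hτ hne
      simp only [Finset.coe_image, Set.mem_image, Finset.mem_coe] at hσ hτ
      obtain ⟨p, hp, rfl⟩ := hσ
      obtain ⟨q, hq, rfl⟩ := hτ
      exact key p hp q hq (fun h => hne (by rw [h]))
    · rw [Finset.card_image_of_injOn hinj]
      simp [T, x]

/-- Theorem 2.8 (consequence): for `n ≥ 10`, `ω(n) ≥ (n² + 2n)/4` when `n` is even and
`ω(n) ≥ (n+1)²/4` when `n` is odd. -/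
theorem stmt5 (n : ℕ) (hn : 10 ≤ n) :
    (Even n → (n ^ 2 + 2 * n) / 4 ≤ birkhoffCliqueNum n) ∧
    (Odd n → (n + 1) ^ 2 / 4 ≤ birkhoffCliqueNum n) := by
  constructor
  · rintro ⟨m, rfl⟩
    have h := clique_bound (m + m) m (by omega)
    rw [Nat.add_sub_cancel] at h
    have e : ((m + m) ^ 2 + 2 * (m + m)) / 4 = (m + 1) * m :=
      Nat.div_eq_of_eq_mul_right (by norm_num) (by ring)
    rwa [e]
  · rintro ⟨m, rfl⟩
    have h := clique_bound (2 * m + 1) m (by omega)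
    have e1 : 2 * m + 1 - m = m + 1 := by omega
    rw [e1] at h
    have e : (2 * m + 1 + 1) ^ 2 / 4 = (m + 1) * (m + 1) :=
      Nat.div_eq_of_eq_mul_right (by norm_num) (by ring)
    rwa [e]
end

section
/- Let H be a subgroup of Sym(n) that is an independent set of the Birkhoff polytope graph G(Ω_n). Then the clique number ω(n) of G(Ω_n) satisfies ω(n) ≤ n!/|H|. In particular, if n = 2k is even with k ≥ 2, then ω(n) ≤ (2k)!/(k!·2^{k−1}). -/
/-- An independent set of the Birkhoff polytope graph `G(Ω_n)`: a set of pairwise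
non-adjacent permutations, where `σ`, `τ` are adjacent iff `σ⁻¹ * τ` is a cycle. -/
def IsBIndep {n : ℕ} (S : Set (Equiv.Perm (Fin n))) : Prop :=
  S.Pairwise fun σ τ => ¬ (σ⁻¹ * τ).IsCycle

theorem clique_le_aux (n : ℕ) (H : Subgroup (Equiv.Perm (Fin n)))
    (hind : IsBIndep (H : Set (Equiv.Perm (Fin n)))) :
    birkhoffCliqueNum n ≤ n.factorial / Nat.card H := by
  apply csSup_le'
  rintro m ⟨S, hS, rfl⟩
  have hidx : n.factorial / Nat.card H = H.index := by
    have h := H.card_mul_index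
    rw [Nat.card_eq_fintype_card (α := Equiv.Perm (Fin n)), Fintype.card_perm,
      Fintype.card_fin] at h
    rw [← h, Nat.mul_div_cancel_left _ Nat.card_pos]
  rw [hidx]
  have hinj : Function.Injective
      (fun σ : S => (QuotientGroup.mk σ.1 : Equiv.Perm (Fin n) ⧸ H)) := by
    intro σ τ h
    by_contra hne
    have hne' : σ.1 ≠ τ.1 := fun h => hne (Subtype.ext h)
    have hc := hS σ.2 τ.2 hne'
    have hm : σ.1⁻¹ * τ.1 ∈ H := QuotientGroup.eq.1 h
    refine hind H.one_mem hm ?_ (by simpa using hc)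
    exact fun h => hc.ne_one h.symm
  have := Nat.card_le_card_of_injective _ hinj
  simpa [Subgroup.index] using this

theorem exists_indep_aux (k : ℕ) (hk : 2 ≤ k) :
    ∃ H : Subgroup (Equiv.Perm (Fin (2 * k))),
      IsBIndep (H : Set (Equiv.Perm (Fin (2 * k)))) ∧
      k.factorial * 2 ^ (k - 1) ≤ Nat.card H := by
  obtain ⟨c, hc⟩ := (Equiv.Perm.exists_with_cycleType_iff (Fin (2 * k))
    (m := Multiset.replicate k 2)).2 ⟨by simp [mul_comm], by
      intro a ha; rw [Multiset.eq_of_mem_replicate ha]⟩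
  have hord : c * c = 1 := by
    rw [← pow_two, ← orderOf_dvd_iff_pow_eq_one, ← Equiv.Perm.lcm_cycleType, hc]
    exact Multiset.lcm_dvd.2 fun b hb => by rw [Multiset.eq_of_mem_replicate hb]
  have hsupp : c.support = Finset.univ := by
    rw [← Finset.card_eq_iff_eq_univ, ← Equiv.Perm.sum_cycleType, hc]
    simp [mul_comm]
  have hfix : ∀ x, c x ≠ x := fun x => by
    rw [← Equiv.Perm.mem_support, hsupp]; simp
  let C := Subgroup.centralizer {c}
  let A := alternatingGroup (Fin (2 * k))
  refine ⟨A ⊓ C, ?_, ?_⟩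
  · intro σ hσ τ hτ _ hcyc
    have hm : σ⁻¹ * τ ∈ A ⊓ C := (A ⊓ C).mul_mem ((A ⊓ C).inv_mem hσ) hτ
    generalize σ⁻¹ * τ = g at hm hcyc
    have hs := hcyc.sign
    rw [Equiv.Perm.mem_alternatingGroup.1 hm.1] at hs
    have hcomm : c * g = g * c := Subgroup.mem_centralizer_iff.1 hm.2 c rfl
    have hev : Even g.support.card := by
      have h0 : ∑ x ∈ g.support, (1 : ZMod 2) = 0 := by
        refine Finset.sum_involution (fun x _ => c x) ?_ ?_ ?_ ?_
        · intros; decide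
        · intro x _ _; exact hfix x
        · intro x hx
          rw [Equiv.Perm.mem_support] at hx ⊢
          intro h
          apply hx
          apply c.injective
          rw [← h]
          exact congrArg (fun p => p x) hcomm |>.trans h |>.trans h.symm
        · intro x _
          exact congrArg (fun p => p x) hord
      simp only [Finset.sum_const, nsmul_eq_mul, mul_one] at h0
      exact (ZMod.natCast_eq_zero_iff_even).1 h0
    rw [hev.neg_one_pow] at hs
    exact absurd hs (by decide)
  · have hC : Nat.card C = k.factorial * 2 ^ k := by
      have := Equiv.Perm.nat_card_centralizer c
      rw [hc] at this
      rw [this]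
      have hk0 : k ≠ 0 := by omega
      simp [mul_comm, Multiset.toFinset_replicate, hk0]
    have : Nontrivial (Fin (2 * k)) := Fin.nontrivial_iff_two_le.2 (by omega)
    have h1 : A.relIndex C ≤ 2 := by
      refine Nat.le_of_dvd (by norm_num) ?_
      have h := Subgroup.relIndex_dvd_index_of_normal A C
      rwa [show A.index = 2 from alternatingGroup.index_eq_two] at h
    have h2 : Nat.card (A ⊓ C : Subgroup _) * A.relIndex C = Nat.card C := by
      rw [← (A.subgroupOf C).card_mul_index, ← Subgroup.inf_subgroupOf_right,
        Nat.card_congr (Subgroup.subgroupOfEquivOfLe (inf_le_right : A ⊓ C ≤ C)).toEquiv,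
        Subgroup.inf_subgroupOf_right]
      rfl
    obtain ⟨m, rfl⟩ : ∃ m, k = m + 1 := ⟨k - 1, by omega⟩
    have h3 := Nat.mul_le_mul_left (Nat.card (A ⊓ C : Subgroup _)) h1
    rw [h2, hC, pow_succ, ← mul_assoc] at h3
    simp only [Nat.add_sub_cancel]
    omega

/-- Theorem 2.9: if `H` is a subgroup of `Sym(n)` that is an independent set of `G(Ω_n)`,
then `ω(n) ≤ n!/|H|`; in particular, for `n = 2k` even (`k ≥ 2`),
`ω(n) ≤ (2k)!/(k!·2^(k-1))`. -/
theorem stmt6 (n : ℕ) (H : Subgroup (Equiv.Perm (Fin n)))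
    (hind : IsBIndep (H : Set (Equiv.Perm (Fin n)))) :
    birkhoffCliqueNum n ≤ n.factorial / Nat.card H ∧
    (∀ k : ℕ, 2 ≤ k → n = 2 * k →
      birkhoffCliqueNum n ≤ (2 * k).factorial / (k.factorial * 2 ^ (k - 1))) := by
  refine ⟨clique_le_aux n H hind, ?_⟩
  rintro k hk rfl
  obtain ⟨K, hK, hcard⟩ := exists_indep_aux k hk
  exact (clique_le_aux _ K hK).trans (Nat.div_le_div_left hcard (by positivity))
end

section
/- Let α(n) denote the independence number of the Birkhoff polytope graph G(Ω_n) and let α̃(n) denote the maximum size of an independent set of G(Ω_n) all of whose elements are even permutations. Then α(n) ≤ 2·α̃(n). -/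
/-- The independence number `α(n)` of the Birkhoff polytope graph `G(Ω_n)`. -/
noncomputable def birkhoffIndepNum (n : ℕ) : ℕ :=
  sSup {k | ∃ S : Finset (Equiv.Perm (Fin n)),
    IsBIndep (S : Set (Equiv.Perm (Fin n))) ∧ S.card = k}

/-- The maximum size `α̃(n)` of an independent set of `G(Ω_n)` consisting of even
permutations. -/
noncomputable def birkhoffEvenIndepNum (n : ℕ) : ℕ :=
  sSup {k | ∃ S : Finset (Equiv.Perm (Fin n)),
    IsBIndep (S : Set (Equiv.Perm (Fin n))) ∧ (∀ σ ∈ S, Equiv.Perm.sign σ = 1) ∧ S.card = k}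

theorem le_birkhoffEvenIndepNum {n : ℕ} (S : Finset (Equiv.Perm (Fin n)))
    (hS : IsBIndep (S : Set (Equiv.Perm (Fin n)))) (he : ∀ σ ∈ S, Equiv.Perm.sign σ = 1) :
    S.card ≤ birkhoffEvenIndepNum n := by
  refine le_csSup ⟨Fintype.card (Equiv.Perm (Fin n)), ?_⟩ ⟨S, hS, he, rfl⟩
  rintro k ⟨T, -, -, rfl⟩
  exact Finset.card_le_univ T

/-- An independent set of permutations of constant sign translates to an even one. -/
theorem card_le_of_sign_eq {n : ℕ} (S : Finset (Equiv.Perm (Fin n)))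
    (hS : IsBIndep (S : Set (Equiv.Perm (Fin n)))) (u : ℤˣ)
    (he : ∀ σ ∈ S, Equiv.Perm.sign σ = u) :
    S.card ≤ birkhoffEvenIndepNum n := by
  rcases S.eq_empty_or_nonempty with rfl | ⟨t, ht⟩
  · simp
  · rw [← Finset.card_map (mulLeftEmbedding t⁻¹)]
    apply le_birkhoffEvenIndepNum
    · intro a ha b hb hab
      simp only [Finset.coe_map, Set.mem_image, Finset.mem_coe, mulLeftEmbedding_apply] at ha hb
      obtain ⟨x, hx, rfl⟩ := ha
      obtain ⟨y, hy, rfl⟩ := hb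
      have hxy : x ≠ y := fun h => hab (by rw [h])
      have := hS hx hy hxy
      have e : (t⁻¹ * x)⁻¹ * (t⁻¹ * y) = x⁻¹ * y := by group
      rw [e]
      exact this
    · intro a ha
      simp only [Finset.mem_map, mulLeftEmbedding_apply] at ha
      obtain ⟨x, hx, rfl⟩ := ha
      rw [Equiv.Perm.sign_mul, Equiv.Perm.sign_inv, he t ht, he x hx, Int.units_mul_self]

/-- Lemma 3.1: `α(n) ≤ 2·α̃(n)`. -/
theorem stmt7 (n : ℕ) : birkhoffIndepNum n ≤ 2 * birkhoffEvenIndepNum n := by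
  refine csSup_le ⟨0, ∅, by simp [IsBIndep], rfl⟩ ?_
  rintro k ⟨S, hS, rfl⟩
  rw [← Finset.card_filter_add_card_filter_not (s := S) (fun σ => Equiv.Perm.sign σ = 1), two_mul]
  apply add_le_add
  · refine card_le_of_sign_eq _ (hS.mono (Finset.coe_subset.2 (Finset.filter_subset _ _))) 1 ?_
    intro σ hσ
    exact (Finset.mem_filter.1 hσ).2
  · refine card_le_of_sign_eq _ (hS.mono (Finset.coe_subset.2 (Finset.filter_subset _ _))) (-1) ?_
    intro σ hσ
    exact (Int.units_eq_one_or _).resolve_left (Finset.mem_filter.1 hσ).2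
end

section
/- Let n = 2k ≥ 4 be even, and let G_n be the intersection of the alternating group Alt(n) with the stabilizer in Sym(n) of the partition of {1,…,2k} into the pairs {j, j+k} for 1 ≤ j ≤ k (i.e., G_n consists of the even permutations σ such that for each j there exists i with σ({j, j+k}) = {i, i+k}). Then G_n is a subgroup of the alternating group with |G_n| = k!·2^{k−1}, and G_n is an independent set of the Birkhoff polytope graph G(Ω_n); equivalently, no nonidentity element of G_n is a cycle. -/
/-- The involution of `{0,…,2k-1}` swapping `j` and `j + k` for every `j < k`. -/
def permBlockSwap (k : ℕ) : Equiv.Perm (Fin (k + k)) :=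
  finSumFinEquiv.symm.trans ((Equiv.sumComm (Fin k) (Fin k)).trans finSumFinEquiv)

/-- The group `Gₙ` (`n = 2k`): the even permutations stabilizing the partition of
`{0,…,2k-1}` into the pairs `{j, j+k}` (equivalently, commuting with the pairing
involution `j ↦ j ± k`). -/
def Gset (k : ℕ) : Set (Equiv.Perm (Fin (k + k))) :=
  {σ | σ ∈ alternatingGroup (Fin (k + k)) ∧
    ∀ j, σ (permBlockSwap k j) = permBlockSwap k (σ j)}

theorem pbs_invol (k : ℕ) (j) : permBlockSwap k (permBlockSwap k j) = j := by
  simp [permBlockSwap]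

theorem pbs_ne (k : ℕ) (j) : permBlockSwap k j ≠ j := by
  intro h
  have h2 : (finSumFinEquiv.symm j).swap = finSumFinEquiv.symm j := by
    rw [← Equiv.apply_eq_iff_eq (finSumFinEquiv (m := k) (n := k))]
    simpa [permBlockSwap] using h
  rcases h3 : finSumFinEquiv.symm j with a | a <;> rw [h3] at h2 <;> simp at h2

theorem pbs_cycleType (k : ℕ) (hk : 2 ≤ k) :
    (permBlockSwap k).cycleType = Multiset.replicate k 2 := by
  have hne : permBlockSwap k ≠ 1 := by
    intro h
    exact pbs_ne k ⟨0, by omega⟩ (by rw [h]; rfl)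
  have ho : orderOf (permBlockSwap k) = 2 := by
    apply orderOf_eq_prime _ hne
    ext j
    simp [pow_two, pbs_invol]
  obtain ⟨n, hn⟩ := Equiv.Perm.cycleType_prime_order (σ := permBlockSwap k)
    (by rw [ho]; exact Nat.prime_two)
  have hs := Equiv.Perm.sum_cycleType (permBlockSwap k)
  have hsupp : (permBlockSwap k).support = Finset.univ := by
    ext j
    simp [pbs_ne]
  rw [hsupp, hn, ho] at hs
  simp at hs
  rw [hn, ho]
  congr 1
  omega

theorem mem_cent (k : ℕ) (σ : Equiv.Perm (Fin (k + k))) :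
    σ ∈ Subgroup.centralizer {permBlockSwap k} ↔
      ∀ j, σ (permBlockSwap k j) = permBlockSwap k (σ j) := by
  rw [Subgroup.mem_centralizer_singleton_iff, Equiv.ext_iff]
  rfl

theorem Gset_eq (k : ℕ) : ((alternatingGroup (Fin (k + k)) ⊓
    Subgroup.centralizer {permBlockSwap k} : Subgroup _) : Set (Equiv.Perm (Fin (k + k)))) =
    Gset k := by
  ext σ
  simp only [SetLike.mem_coe, Subgroup.mem_inf, mem_cent]
  rfl

theorem not_cycle (k : ℕ) (σ) (hσ : σ ∈ Gset k) : ¬ Equiv.Perm.IsCycle σ := by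
  intro hc
  obtain ⟨ha, hs⟩ := hσ
  rw [Equiv.Perm.mem_alternatingGroup, hc.sign] at ha
  have he : ((σ.support.card : ℕ) : ZMod 2) = 0 := by
    have : ∑ x ∈ σ.support, (1 : ZMod 2) = 0 := by
      apply Finset.sum_involution (fun x _ => permBlockSwap k x)
      · intros; decide
      · intro a _ _; exact pbs_ne k a
      · intro a h
        rw [Equiv.Perm.mem_support] at h ⊢
        rw [hs]
        exact fun h' => h ((permBlockSwap k).injective h')
      · intro a _; exact pbs_invol k a
    simpa using this
  have he2 : Even σ.support.card := (ZMod.natCast_eq_zero_iff_even).1 he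
  rw [he2.neg_one_pow] at ha
  exact absurd ha (by decide)

theorem Gset_card (k : ℕ) (hk : 2 ≤ k) : (Gset k).ncard = k.factorial * 2 ^ (k - 1) := by
  rw [← Gset_eq, ← Nat.card_coe_set_eq]
  have h1 : Nat.card (Subgroup.centralizer {permBlockSwap k}) = k.factorial * 2 ^ k := by
    rw [Equiv.Perm.nat_card_centralizer, pbs_cycleType k hk]
    have : (Multiset.replicate k 2).toFinset = {2} := by
      rw [Multiset.toFinset_replicate, if_neg (by omega)]
    simp [this, mul_comm]
    left
    rw [← two_mul, mul_comm]
    simp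
  set C := Subgroup.centralizer {permBlockSwap k} with hC
  have h2 : (alternatingGroup (Fin (k + k))).relIndex C = 2 := by
    rw [alternatingGroup, Subgroup.relIndex_ker]
    have : C.map Equiv.Perm.sign = ⊤ := by
      rw [eq_top_iff]
      intro u _
      rcases Int.units_eq_one_or u with rfl | rfl
      · exact one_mem _
      · let a : Fin (k + k) := ⟨0, by omega⟩
        refine ⟨Equiv.swap a (permBlockSwap k a), ?_, Equiv.Perm.sign_swap (pbs_ne k a).symm⟩
        rw [SetLike.mem_coe, mem_cent]
        intro j
        by_cases h1 : j = a
        · subst h1; simp [pbs_invol]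
        by_cases h2 : j = permBlockSwap k a
        · subst h2; simp [pbs_invol]
        rw [Equiv.swap_apply_of_ne_of_ne h1 h2, Equiv.swap_apply_of_ne_of_ne]
        · intro h; apply h2; rw [← h, pbs_invol]
        · intro h; exact h1 ((permBlockSwap k).injective h)
    rw [this]
    simp
  have h3 := Subgroup.relIndex_mul_relIndex ⊥ (alternatingGroup (Fin (k + k)) ⊓ C) C bot_le
    inf_le_right
  rw [Subgroup.relIndex_bot_left, Subgroup.relIndex_bot_left, Subgroup.inf_relIndex_right, h2, h1] at h3
  obtain ⟨m, rfl⟩ : ∃ m, k = m + 1 := ⟨k - 1, by omega⟩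
  rw [pow_succ, ← mul_assoc] at h3
  exact Nat.eq_of_mul_eq_mul_right (by norm_num) h3

/-- Theorem 3.2: for `n = 2k ≥ 4`, `Gₙ = Alt(n) ∩ (partition stabilizer)` is a subgroup
of the alternating group of order `k!·2^(k-1)` which is an independent set of `G(Ω_n)`;
equivalently, no element of `Gₙ` is a cycle. -/
theorem stmt8 (k : ℕ) (hk : 2 ≤ k) :
    (∃ H : Subgroup (Equiv.Perm (Fin (k + k))),
      (H : Set (Equiv.Perm (Fin (k + k)))) = Gset k ∧
      H ≤ alternatingGroup (Fin (k + k))) ∧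
    (Gset k).ncard = k.factorial * 2 ^ (k - 1) ∧
    IsBIndep (Gset k) ∧
    (∀ σ ∈ Gset k, ¬ Equiv.Perm.IsCycle σ) := by
  refine ⟨⟨_, Gset_eq k, inf_le_left⟩, Gset_card k hk, ?_, not_cycle k⟩
  intro σ hσ τ hτ _
  apply not_cycle
  rw [← Gset_eq] at *
  exact mul_mem (inv_mem hσ) hτ
end

section
/- Let n = 2k ≥ 4 be even, and let G_n be the intersection of the alternating group Alt(n) with the stabilizer in Sym(n) of the partition of {1,…,2k} into the pairs {j, j+k} for 1 ≤ j ≤ k. Then G_n is a maximal independent set of the Birkhoff polytope graph G(Ω_n): it is an independent set, and for every σ ∈ Sym(n) \ G_n the set G_n ∪ {σ} is not independent; equivalently, every coset σG_n with σ ∉ G_n contains a cycle. -/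
open Equiv Equiv.Perm in
lemma grow_cycle {α : Type*} [DecidableEq α] (f : Equiv.Perm α) (hf : f.IsCycle)
    (q x : α) (hq : f q ≠ q) (hx : f x = x) : (f * Equiv.swap q x).IsCycle := by
  have hqx : q ≠ x := by rintro rfl; exact hq hx
  set g := f * Equiv.swap q x with hg
  have gq : g q = x := by simp [hg, hx]
  have gx : g x = f q := by simp [hg]
  have go : ∀ v, v ≠ q → v ≠ x → g v = f v := by
    intro v h1 h2; simp [hg, Equiv.swap_apply_of_ne_of_ne h1 h2]
  have key : ∀ v, v ≠ x → g.SameCycle v (f v) := by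
    intro v hv
    by_cases h : v = q
    · subst h
      exact ⟨2, by rw [← gx, ← gq]; rfl⟩
    · exact ⟨1, by simp [go v h hv]⟩
  have keyn : ∀ n : ℕ, g.SameCycle q ((f ^ n) q) := by
    intro n
    induction n with
    | zero => exact SameCycle.refl _ _
    | succ n ih =>
      rw [pow_succ', Equiv.Perm.mul_apply]
      by_cases h : (f ^ n) q = x
      · rw [h] at ih ⊢; rwa [hx]
      · exact ih.trans (key _ h)
  have keyi : ∀ n : ℕ, g.SameCycle q ((f ^ (-(n:ℤ))) q) := by
    intro n
    induction n with
    | zero => exact SameCycle.refl _ _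
    | succ n ih =>
      have e : f ((f ^ (-((n + 1 : ℕ):ℤ))) q) = (f ^ (-(n:ℤ))) q := by
        rw [← Equiv.Perm.mul_apply, ← zpow_one_add]
        congr 2
        push_cast; ring
      by_cases h : (f ^ (-((n + 1 : ℕ):ℤ))) q = x
      · rw [h] at e ⊢; rw [hx] at e; rwa [e]
      · have := key _ h
        rw [e] at this
        exact ih.trans this.symm
  refine ⟨q, by rw [gq]; exact hqx.symm, ?_⟩
  intro y hy
  by_cases h1 : y = q
  · subst h1; exact SameCycle.refl _ _
  by_cases h2 : y = x
  · subst h2; exact ⟨1, by simp [gq]⟩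
  rw [go y h1 h2] at hy
  obtain ⟨i, hi⟩ := hf.sameCycle hq hy
  obtain ⟨n, rfl | rfl⟩ := i.eq_nat_or_neg
  · rw [← hi]; exact_mod_cast keyn n
  · rw [← hi]; exact keyi n

lemma grow_cycle_left {α : Type*} [DecidableEq α] (f : Equiv.Perm α) (hf : f.IsCycle)
    (q x : α) (hq : f q ≠ q) (hx : f x = x) : (Equiv.swap x q * f).IsCycle := by
  have h := grow_cycle f⁻¹ hf.inv q x
    (by intro h; apply hq; conv_lhs => rw [← h]
        simp)
    (by rw [Equiv.Perm.inv_eq_iff_eq]; exact hx.symm)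
  have := h.inv
  rw [mul_inv_rev, inv_inv, Equiv.swap_inv, Equiv.swap_comm] at this
  exact this

lemma main_cycle {α : Type*} [Fintype α] [DecidableEq α] (i : α → α)
    (hi : ∀ v, i (i v) = v) (hi0 : ∀ v, i v ≠ v) :
    ∀ (N : ℕ) (m : α → α), (∀ v, m (m v) = v) → (∀ v, m v ≠ v) →
      (Finset.univ.filter (fun v => m v ≠ i v)).card = N → (∃ v, m v ≠ i v) →
      ∃ c : Equiv.Perm α, c.IsCycle ∧ (∀ v, c (i v) = m (c v)) ∧
        (∀ v, c v ≠ v → m v ≠ i v) ∧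
        ∃ p r, p ≠ r ∧ c p = p ∧ c (i p) ≠ i p ∧ c r = r ∧ c (i r) ≠ i r := by
  intro N
  induction N using Nat.strong_induction_on with
  | _ N ih =>
  intro m hm hm0 hN ⟨x, hx⟩
  obtain ⟨y, hy⟩ : ∃ y, y = i x := ⟨_, rfl⟩
  obtain ⟨z, hz⟩ : ∃ z, z = m x := ⟨_, rfl⟩
  obtain ⟨w, hw⟩ : ∃ w, w = i z := ⟨_, rfl⟩
  obtain ⟨u, hu⟩ : ∃ u, u = m y := ⟨_, rfl⟩
  have iy : i y = x := by rw [hy, hi]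
  have mz : m z = x := by rw [hz, hm]
  have iw : i w = z := by rw [hw, hi]
  have mu : m u = y := by rw [hu, hm]
  have xy : x ≠ y := by rw [hy]; exact (hi0 x).symm
  have xz : x ≠ z := by rw [hz]; exact (hm0 x).symm
  have zw : z ≠ w := by rw [hw]; exact (hi0 z).symm
  have yu : y ≠ u := by rw [hu]; exact (hm0 y).symm
  have yz : y ≠ z := by rw [hy, hz]; exact hx.symm
  have xw : x ≠ w := by rintro h; apply yz; rw [hy, h, iw]
  have yw : y ≠ w := by rintro h; apply xz; rw [← iy, h, iw]
  have xu : x ≠ u := by rintro h; apply yz; rw [← mu, ← h, hz]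
  have zu : z ≠ u := by rintro h; apply xy; rw [← mz, h, mu]
  obtain ⟨m', hm'⟩ : ∃ m' : α → α, ∀ v, m' v = Equiv.swap y z (m (Equiv.swap y z v)) :=
    ⟨_, fun _ => rfl⟩
  have m'x : m' x = y := by
    rw [hm', Equiv.swap_apply_of_ne_of_ne xy xz, ← hz, Equiv.swap_apply_right]
  have m'y : m' y = x := by
    rw [hm', Equiv.swap_apply_left, mz, Equiv.swap_apply_of_ne_of_ne xy xz]
  have m'z : m' z = u := by
    rw [hm', Equiv.swap_apply_right, ← hu, Equiv.swap_apply_of_ne_of_ne yu.symm zu.symm]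
  have m'u : m' u = z := by
    rw [hm', Equiv.swap_apply_of_ne_of_ne yu.symm zu.symm, mu, Equiv.swap_apply_left]
  have m'o : ∀ v, v ≠ x → v ≠ y → v ≠ z → v ≠ u → m' v = m v := by
    intro v h1 h2 h3 h4
    rw [hm', Equiv.swap_apply_of_ne_of_ne h2 h3, Equiv.swap_apply_of_ne_of_ne]
    · intro h; apply h4; rw [hu, ← h, hm]
    · intro h; apply h1; rw [← mz, ← h, hm]
  have hm'2 : ∀ v, m' (m' v) = v := by intro v; simp [hm', hm]
  have hm'0 : ∀ v, m' v ≠ v := by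
    intro v h
    rw [hm', Equiv.swap_apply_eq_iff] at h
    exact hm0 _ h
  have mono : ∀ v, m' v ≠ i v → m v ≠ i v := by
    intro v hv
    by_cases h1 : v = x
    · subst h1; exact hx
    by_cases h2 : v = y
    · subst h2; rw [← hu, iy]; exact xu.symm
    by_cases h3 : v = z
    · subst h3; rw [mz, ← hw]; exact xw
    by_cases h4 : v = u
    · subst h4; rw [mu]; intro h; apply xu; rw [← iy, h, hi]
    rwa [← m'o v h1 h2 h3 h4]
  have hlt : (Finset.univ.filter (fun v => m' v ≠ i v)).card < N := by
    rw [← hN]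
    apply Finset.card_lt_card
    rw [Finset.ssubset_iff_of_subset]
    · exact ⟨x, by simpa using hx, by simp [m'x, hy]⟩
    · intro v; simpa using mono v
  have IH := ih _ hlt m' hm'2 hm'0 rfl
  have my : m y ≠ i y := by rw [← hu, iy]; exact xu.symm
  have mzi : m z ≠ i z := by rw [mz, ← hw]; exact xw
  have mui : m u ≠ i u := by
    rw [mu]; intro h; apply xu; rw [← iy, h, hi]
  by_cases huw : u = w
  · subst huw
    by_cases hall : ∃ v, m' v ≠ i v
    · obtain ⟨c', hc', hc1, hc2, p, r, hpr, hp, hp', hr, hr'⟩ := IH hall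
      clear IH ih
      have cx : c' x = x := by by_contra h; exact hc2 _ h (by rw [m'x, hy])
      have cy : c' y = y := by by_contra h; exact hc2 _ h (by rw [m'y, iy])
      have cz : c' z = z := by by_contra h; exact hc2 _ h (by rw [m'z, hw])
      have cu : c' u = u := by by_contra h; exact hc2 _ h (by rw [m'u, iw])
      have avoid : ∀ s, c' (i s) ≠ i s → s ≠ x ∧ s ≠ y ∧ s ≠ z ∧ s ≠ u := by
        intro s hs
        refine ⟨?_, ?_, ?_, ?_⟩ <;> rintro rfl <;> apply hs
        · rw [← hy, cy]
        · rw [iy, cx]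
        · rw [← hw, cu]
        · rw [iw, cz]
      obtain ⟨q, hq⟩ : ∃ q, q = i p := ⟨_, rfl⟩
      have iq : i q = p := by rw [hq, hi]
      obtain ⟨px, py, pz, pu⟩ := avoid p hp'
      obtain ⟨rx, ry, rz, ru⟩ := avoid r hr'
      rw [← hq] at hp'
      have qx : q ≠ x := by rintro rfl; exact hp' cx
      have qy : q ≠ y := by rintro rfl; exact hp' cy
      have qz : q ≠ z := by rintro rfl; exact hp' cz
      have qu : q ≠ u := by rintro rfl; exact hp' cu
      have pq : p ≠ q := by rintro rfl; exact hp' hp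
      have rq : r ≠ q := by rintro rfl; exact hp' hr
      have hcy := grow_cycle _ (grow_cycle _ (grow_cycle _ (grow_cycle c' hc' q x hp' cx) x p
        (by simpa [Equiv.swap_apply_right] using (by
              intro h; exact qx (c'.injective (h.trans cx.symm))))
        (by simp [Equiv.swap_apply_of_ne_of_ne pq px, hp])) p z
        (by simp only [Equiv.Perm.mul_apply, Equiv.swap_apply_right, Equiv.swap_apply_left]
            intro h; exact pq (c'.injective (h.trans hp.symm)).symm)
        (by simp [Equiv.swap_apply_of_ne_of_ne qz.symm xz.symm,
              Equiv.swap_apply_of_ne_of_ne xz.symm pz.symm, cz])) z y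
        (by simp only [Equiv.Perm.mul_apply, Equiv.swap_apply_right, Equiv.swap_apply_left]
            intro h; exact qz (c'.injective (h.trans cz.symm)))
        (by simp [Equiv.swap_apply_of_ne_of_ne qy.symm xy.symm,
              Equiv.swap_apply_of_ne_of_ne xy.symm py.symm,
              Equiv.swap_apply_of_ne_of_ne py.symm yz, cy])
      obtain ⟨c, hc⟩ : ∃ c, c = c' * Equiv.swap q x * Equiv.swap x p * Equiv.swap p z *
        Equiv.swap z y := ⟨_, rfl⟩
      rw [← hc] at hcy
      have ccy : c y = c' q := by
        rw [hc]; simp [Equiv.Perm.mul_apply]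
      have ccz : c z = y := by
        rw [hc]; simp only [Equiv.Perm.mul_apply, Equiv.swap_apply_def]; grind
      have ccp : c p = z := by
        rw [hc]; simp only [Equiv.Perm.mul_apply, Equiv.swap_apply_def]; grind
      have ccx : c x = p := by
        rw [hc]; simp only [Equiv.Perm.mul_apply, Equiv.swap_apply_def]; grind
      have ccq : c q = x := by
        rw [hc]; simp only [Equiv.Perm.mul_apply, Equiv.swap_apply_def]; grind
      have cco : ∀ v, v ≠ x → v ≠ y → v ≠ z → v ≠ p → v ≠ q → c v = c' v := by
        intro v _ _ _ _ _
        rw [hc]; simp only [Equiv.Perm.mul_apply, Equiv.swap_apply_def]; grind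
      clear hc
      have mq : m' q ≠ i q := hc2 q hp'
      have mp : m' p ≠ i p := by
        intro h; apply mq; rw [iq, hq, ← h, hm'2]
      have m'p : m' p = c' q := by rw [hq, hc1, hp]
      refine ⟨c, hcy, ?_, ?_, u, r, ru.symm, ?_, ?_, ?_, ?_⟩
      · intro v
        have h1 := hc1 v
        have h2 : c' v = x → v = x := fun h => c'.injective (h.trans cx.symm)
        have h3 : c' v = y → v = y := fun h => c'.injective (h.trans cy.symm)
        have h4 : c' v = z → v = z := fun h => c'.injective (h.trans cz.symm)
        have h5 : c' v = u → v = u := fun h => c'.injective (h.trans cu.symm)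
        have h6 : c' q ≠ x := fun h => qx (c'.injective (h.trans cx.symm))
        have h7 : c' q ≠ y := fun h => qy (c'.injective (h.trans cy.symm))
        have h8 : c' q ≠ z := fun h => qz (c'.injective (h.trans cz.symm))
        have h9 : c' q ≠ u := fun h => qu (c'.injective (h.trans cu.symm))
        have h10 := m'o p px py pz pu
        have h11 := m'o (c' q) h6 h7 h8 h9
        have h12 : m' (c' q) = p := by rw [← m'p, hm'2]
        have hv := hi v
        by_cases e1 : v = x
        · subst e1; rw [← hy, ccy, ccx, ← h10, m'p]
        by_cases e2 : v = y
        · subst e2; rw [iy, ccy, ccx, ← h11, h12]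
        by_cases e3 : v = z
        · subst e3; rw [← hw, ccz, cco u xu.symm yu.symm zu.symm pu.symm qu.symm, cu, hu]
        by_cases e4 : v = u
        · subst e4; rw [iw, ccz, cco v e1 e2 e3 pu.symm qu.symm, cu, mu]
        by_cases e5 : v = p
        · subst e5; rw [← hq, ccq, ccp, mz]
        by_cases e6 : v = q
        · subst e6; rw [iq, ccq, ccp, hz]
        rw [cco v e1 e2 e3 e5 e6, cco (i v), h1, m'o]
        all_goals grind
      · intro v hv
        by_cases e1 : v = x
        · subst e1; exact hx
        by_cases e2 : v = y
        · subst e2; exact my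
        by_cases e3 : v = z
        · subst e3; exact mzi
        by_cases e5 : v = p
        · subst e5; exact mono _ mp
        by_cases e6 : v = q
        · subst e6; exact mono _ mq
        rw [cco v e1 e2 e3 e5 e6] at hv
        exact mono _ (hc2 _ hv)
      · rw [cco u xu.symm yu.symm zu.symm pu.symm qu.symm, cu]
      · rw [iw, ccz]; exact yz
      · rw [cco r rx ry rz hpr.symm rq, hr]
      · rw [cco (i r)]
        · exact hr'
        · rintro h; apply ry; rw [hy, ← h, hi]
        · rintro h; apply rx; rw [← iy, ← h, hi]
        · rintro h; apply ru; rw [hw, ← h, hi]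
        · rintro h; apply rq; rw [hq, ← h, hi]
        · rintro h; apply hpr; rw [← iq, ← h, hi]
    · push Not at hall
      refine ⟨Equiv.swap y z, Equiv.Perm.isCycle_swap yz, ?_, ?_, x, u, xu, ?_, ?_, ?_, ?_⟩
      · intro v; rw [← hall, hm']; simp
      · intro v hv
        by_cases e2 : v = y
        · subst e2; exact my
        by_cases e3 : v = z
        · subst e3; exact mzi
        exact absurd (Equiv.swap_apply_of_ne_of_ne e2 e3) hv
      · exact Equiv.swap_apply_of_ne_of_ne xy xz
      · rw [← hy, Equiv.swap_apply_left]; exact yz.symm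
      · exact Equiv.swap_apply_of_ne_of_ne yu.symm zu.symm
      · rw [iw, Equiv.swap_apply_right]; exact yz
  · obtain ⟨c', hc', hc1, hc2, p, r, hpr, hp, hp', hr, hr'⟩ := IH ⟨z, by rw [m'z, ← hw]; exact huw⟩
    clear IH ih
    have cx : c' x = x := by by_contra h; exact hc2 _ h (by rw [m'x, hy])
    have cy : c' y = y := by by_contra h; exact hc2 _ h (by rw [m'y, iy])
    have step : ∀ a b, (a = x ∨ a = y) → m a ≠ i a → m b ≠ i b → c' b ≠ b →
        (∀ v, Equiv.swap a b (m' v) = m (Equiv.swap a b v)) →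
        ∃ c : Equiv.Perm α, c.IsCycle ∧ (∀ v, c (i v) = m (c v)) ∧
        (∀ v, c v ≠ v → m v ≠ i v) ∧
        ∃ p r, p ≠ r ∧ c p = p ∧ c (i p) ≠ i p ∧ c r = r ∧ c (i r) ≠ i r := by
      intro a b ha hma hmb hb hsw
      have ca : c' a = a := by rcases ha with rfl | rfl <;> assumption
      have cia : c' (i a) = i a := by
        rcases ha with rfl | rfl
        · rw [← hy, cy]
        · rw [iy, cx]
      have fix : ∀ s, c' s = s → c' (i s) ≠ i s → (Equiv.swap a b * c') s = s := by
        intro s h1 h2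
        rw [Equiv.Perm.mul_apply, h1, Equiv.swap_apply_of_ne_of_ne]
        · rintro rfl; exact h2 cia
        · rintro rfl; exact hb h1
      have mov : ∀ s, c' s ≠ s → (Equiv.swap a b * c') s ≠ s := by
        intro s h1 h2
        rw [Equiv.Perm.mul_apply, Equiv.swap_apply_eq_iff] at h2
        by_cases e1 : s = a
        · subst e1; exact h1 ca
        by_cases e2 : s = b
        · subst e2
          rw [Equiv.swap_apply_right] at h2
          exact e1 (c'.injective (h2.trans ca.symm))
        rw [Equiv.swap_apply_of_ne_of_ne e1 e2] at h2
        exact h1 h2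
      refine ⟨Equiv.swap a b * c', grow_cycle_left c' hc' b a hb ca, ?_, ?_, p, r, hpr,
        fix p hp hp', mov _ hp', fix r hr hr', mov _ hr'⟩
      · intro v
        rw [Equiv.Perm.mul_apply, Equiv.Perm.mul_apply, hc1, hsw]
      · intro v hv
        by_cases e1 : v = a
        · subst e1; exact hma
        by_cases e2 : v = b
        · subst e2; exact hmb
        by_cases e3 : c' v = v
        · rw [Equiv.Perm.mul_apply, e3, Equiv.swap_apply_of_ne_of_ne e1 e2] at hv
          exact absurd rfl hv
        exact mono _ (hc2 _ e3)
    by_cases hzc : c' z = z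
    · have hcw : c' w = u := by rw [hw, hc1, hzc, m'z]
      apply step x u (Or.inl rfl) hx mui
      · intro h; exact huw (c'.injective (h.trans hcw.symm))
      · intro v
        by_cases e1 : v = x
        · subst e1
          rw [m'x, Equiv.swap_apply_left, mu, Equiv.swap_apply_of_ne_of_ne xy.symm yu]
        by_cases e2 : v = y
        · subst e2
          rw [m'y, Equiv.swap_apply_left, Equiv.swap_apply_of_ne_of_ne xy.symm yu, hu]
        by_cases e3 : v = z
        · subst e3
          rw [m'z, Equiv.swap_apply_right, Equiv.swap_apply_of_ne_of_ne xz.symm zu, mz]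
        by_cases e4 : v = u
        · subst e4
          rw [m'u, Equiv.swap_apply_right, Equiv.swap_apply_of_ne_of_ne xz.symm zu, hz]
        rw [m'o v e1 e2 e3 e4, Equiv.swap_apply_of_ne_of_ne e1 e4, Equiv.swap_apply_of_ne_of_ne]
        · intro h; apply e3; rw [hz, ← h, hm]
        · intro h; apply e2; rw [← mu, ← h, hm]
    · apply step y z (Or.inr rfl) my mzi hzc
      intro v; rw [hm']; simp

lemma bswap_invol (k : ℕ) (v : Fin (k + k)) : permBlockSwap k (permBlockSwap k v) = v := by
  simp [permBlockSwap]

lemma bswap_ne (k : ℕ) (v : Fin (k + k)) : permBlockSwap k v ≠ v := by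
  intro h
  simp only [permBlockSwap, Equiv.trans_apply] at h
  rw [← Equiv.eq_symm_apply] at h
  rcases h' : finSumFinEquiv.symm v with a | a <;> rw [h'] at h <;> simp at h

lemma no_cycle (k : ℕ) (c : Equiv.Perm (Fin (k + k))) (h : c ∈ Gset k) : ¬ c.IsCycle := by
  intro hc
  obtain ⟨h1, h2⟩ := h
  rw [Equiv.Perm.mem_alternatingGroup, hc.sign] at h1
  have hev : Even c.support.card := by
    have := Finset.sum_involution (s := c.support) (f := fun _ => (1 : ZMod 2))
      (fun v _ => permBlockSwap k v) (fun _ _ => by decide) (fun v _ _ => bswap_ne k v)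
      (fun v hv => by
        rw [Equiv.Perm.mem_support] at hv ⊢
        rw [h2]
        exact fun h => hv ((permBlockSwap k).injective h)) (fun v _ => bswap_invol k v)
    rw [Finset.sum_const, nsmul_one] at this
    rwa [ZMod.natCast_eq_zero_iff_even] at this
  rw [hev.neg_one_pow] at h1
  exact absurd h1 (by decide)

lemma exists_cycle (k : ℕ) (hk : 2 ≤ k) (σ : Equiv.Perm (Fin (k + k))) (hσ : σ ∉ Gset k) :
    ∃ τ ∈ Gset k, Equiv.Perm.IsCycle (σ * τ) := by
  have red : ∀ c : Equiv.Perm (Fin (k + k)), c.IsCycle →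
      (∀ v, c (permBlockSwap k v) = σ (permBlockSwap k (σ⁻¹ (c v)))) →
      Equiv.Perm.sign c = Equiv.Perm.sign σ → ∃ τ ∈ Gset k, Equiv.Perm.IsCycle (σ * τ) := by
    intro c hc h1 h2
    refine ⟨σ⁻¹ * c, ⟨?_, ?_⟩, by rwa [mul_inv_cancel_left]⟩
    · rw [Equiv.Perm.mem_alternatingGroup, map_mul, Equiv.Perm.sign_inv, h2, Int.units_mul_self]
    · intro j
      rw [Equiv.Perm.mul_apply, h1]; simp
  by_cases h : ∀ v, σ (permBlockSwap k (σ⁻¹ v)) = permBlockSwap k v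
  · have hcomm : ∀ j, σ (permBlockSwap k j) = permBlockSwap k (σ j) := by
      intro j; rw [← h (σ j)]; simp
    have hs : Equiv.Perm.sign σ = -1 := by
      rcases Int.units_eq_one_or (Equiv.Perm.sign σ) with h1 | h1
      · exact absurd ⟨Equiv.Perm.mem_alternatingGroup.2 h1, hcomm⟩ hσ
      · exact h1
    obtain ⟨a⟩ : Nonempty (Fin (k + k)) := ⟨⟨0, by omega⟩⟩
    have hne := (bswap_ne k a).symm
    refine red (Equiv.swap a (permBlockSwap k a)) (Equiv.Perm.isCycle_swap hne) ?_ ?_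
    · intro v
      rw [h]
      by_cases e1 : v = a
      · subst e1; simp [bswap_invol]
      by_cases e2 : v = permBlockSwap k a
      · subst e2; simp [bswap_invol]
      rw [Equiv.swap_apply_of_ne_of_ne e1 e2, Equiv.swap_apply_of_ne_of_ne]
      · intro h; apply e2; rw [← h, bswap_invol]
      · intro h; exact e1 ((permBlockSwap k).injective h)
    · rw [hs, Equiv.Perm.sign_swap hne]
  · push Not at h
    obtain ⟨c, hc, h1, -, p, r, -, hp, hp', -, -⟩ := main_cycle (permBlockSwap k)
      (bswap_invol k) (bswap_ne k) _ (fun v => σ (permBlockSwap k (σ⁻¹ v)))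
      (fun v => by simp [bswap_invol])
      (fun v hv => bswap_ne k (σ⁻¹ v) (by rw [Equiv.Perm.eq_inv_iff_eq]; exact hv)) rfl h
    by_cases hs : Equiv.Perm.sign c = Equiv.Perm.sign σ
    · exact red c hc h1 hs
    · refine red (c * Equiv.swap (permBlockSwap k p) p) (grow_cycle c hc _ _ hp' hp) ?_ ?_
      · intro v
        have : Equiv.swap (permBlockSwap k p) p (permBlockSwap k v) =
            permBlockSwap k (Equiv.swap (permBlockSwap k p) p v) := by
          by_cases e1 : v = p
          · subst e1; simp [bswap_invol]
          by_cases e2 : v = permBlockSwap k p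
          · subst e2; simp [bswap_invol]
          rw [Equiv.swap_apply_of_ne_of_ne e2 e1, Equiv.swap_apply_of_ne_of_ne]
          · intro h; exact e1 ((permBlockSwap k).injective h)
          · intro h; apply e2; rw [← h, bswap_invol]
        rw [Equiv.Perm.mul_apply, Equiv.Perm.mul_apply, this, h1]
      · rw [map_mul, Equiv.Perm.sign_swap (bswap_ne k p)]
        rcases Int.units_eq_one_or (Equiv.Perm.sign σ) with h1 | h1 <;>
        rcases Int.units_eq_one_or (Equiv.Perm.sign c) with h2 | h2 <;>
        rw [h1, h2] at hs <;> rw [h1, h2] <;> simp at hs ⊢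

lemma gset_inv_mul (k : ℕ) (σ τ : Equiv.Perm (Fin (k + k))) (h1 : σ ∈ Gset k)
    (h2 : τ ∈ Gset k) : σ⁻¹ * τ ∈ Gset k := by
  refine ⟨mul_mem (inv_mem h1.1) h2.1, fun j => ?_⟩
  rw [Equiv.Perm.mul_apply, Equiv.Perm.mul_apply, h2.2, Equiv.Perm.inv_eq_iff_eq, h1.2]
  simp


/-- Theorem 3.4: for `n = 2k ≥ 4`, `Gₙ` is a maximal independent set of `G(Ω_n)`:
it is independent, no element outside can be adjoined, and every coset `σGₙ` with
`σ ∉ Gₙ` contains a cycle. -/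
theorem stmt9 (k : ℕ) (hk : 2 ≤ k) :
    IsBIndep (Gset k) ∧
    (∀ σ : Equiv.Perm (Fin (k + k)), σ ∉ Gset k → ¬ IsBIndep (insert σ (Gset k))) ∧
    (∀ σ : Equiv.Perm (Fin (k + k)), σ ∉ Gset k →
      ∃ τ ∈ Gset k, Equiv.Perm.IsCycle (σ * τ)) := by
  refine ⟨fun σ hσ τ hτ _ => no_cycle k _ (gset_inv_mul k σ τ hσ hτ), ?_, exists_cycle k hk⟩
  intro σ hσ hind
  have hσ' : σ⁻¹ ∉ Gset k := by
    intro h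
    apply hσ
    have := gset_inv_mul k _ 1 h ⟨one_mem _, fun j => rfl⟩
    simpa using this
  obtain ⟨τ, hτ, hc⟩ := exists_cycle k hk _ hσ'
  exact hind (Set.mem_insert _ _) (Set.mem_insert_of_mem _ hτ)
    (by rintro rfl; exact hσ hτ) hc
end

section
/- Let n = 2k ≥ 4 be even, and let G_n be the intersection of the alternating group Alt(n) with the stabilizer in Sym(n) of the partition of {1,…,2k} into the pairs {j, j+k} for 1 ≤ j ≤ k. Identify G_n with a subgroup of Sym(n+1) consisting of permutations that fix the point n+1. Then G_n is a maximal independent set of the Birkhoff polytope graph G(Ω_{n+1}): it is an independent set, and for every σ ∈ Sym(n+1) \ G_n the set G_n ∪ {σ} is not independent. -/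
/-- The direct sum `x ⊕ y` of two permutations, acting as `x` on the block
`{0,…,a-1}` and as `y` on the block `{a,…,a+b-1}`. -/
def permOplus {a b : ℕ} (x : Equiv.Perm (Fin a)) (y : Equiv.Perm (Fin b)) :
    Equiv.Perm (Fin (a + b)) :=
  finSumFinEquiv.symm.trans ((Equiv.sumCongr x y).trans finSumFinEquiv)

/-- `Gₙ` viewed inside `Sym(n+1)` (`n = 2k`) as the permutations fixing the extra
point `n` (0-based: the point `2k`). -/
def GsetExt (k : ℕ) : Set (Equiv.Perm (Fin (k + k + 1))) :=
  (fun σ => permOplus σ (1 : Equiv.Perm (Fin 1))) '' Gset k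


section Aux

open Equiv Equiv.Perm

/-- Multiplying a cycle by a transposition of a moved and a fixed point gives a cycle. -/
theorem aux_attach {X : Type*} [Fintype X] [DecidableEq X] (τ : Perm X) (hτ : τ.IsCycle)
    {x y : X} (hx : τ x ≠ x) (hy : τ y = y) : (swap x y * τ).IsCycle := by
  have hxy : x ≠ y := by rintro rfl; exact hx hy
  have h1 : swap x y * τ = swap y x * (toList τ x).formPerm := by
    rw [formPerm_toList, hτ.cycleOf_eq hx, swap_comm]
  have hy' : y ∉ toList τ x := by
    rw [mem_toList_iff]
    rintro ⟨h, -⟩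
    exact hxy ((h.symm.eq_of_left hy).symm)
  have hnd := nodup_toList τ x
  have h0 : 0 < (toList τ x).length := by
    rw [length_toList, hτ.cycleOf_eq hx]
    exact lt_of_lt_of_le zero_lt_two hτ.two_le_card_support
  rw [h1]
  obtain ⟨l, hl⟩ : ∃ l, toList τ x = x :: l := by
    cases hc : toList τ x with
    | nil => simp [hc] at h0
    | cons z l =>
      have : (toList τ x)[0] = x := by rw [getElem_toList]; simp
      simp only [hc, List.getElem_cons_zero] at this
      exact ⟨l, by rw [this]⟩
  rw [hl] at hy' hnd ⊢
  rw [← List.formPerm_cons_cons]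
  apply List.isCycle_formPerm
  · exact List.nodup_cons.2 ⟨hy', hnd⟩
  · simp

/-- The support after attaching a point. -/
theorem aux_attach_supp {X : Type*} [DecidableEq X] (τ : Perm X)
    {x y : X} (hx : τ x ≠ x) (hy : τ y = y) (z : X) :
    (swap x y * τ) z ≠ z ↔ τ z ≠ z ∨ z = y := by
  have hxy : x ≠ y := by rintro rfl; exact hx hy
  have hinj := τ.injective
  rw [Perm.mul_apply, swap_apply_def]
  by_cases hz : z = y
  · subst hz; simp [hy, hxy.symm, hxy]
  · have : τ z ≠ y := fun h => hz (hinj (h.trans hy.symm))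
    simp only [this, hz, if_false, or_false]
    by_cases h2 : τ z = x
    · simp only [h2, if_true]
      constructor
      · intro _ h3; subst h3; exact hx h2
      · intro _ h3; exact hz h3.symm
    · simp [h2]

theorem aux_step {X : Type*} [DecidableEq X] (w v : Perm X)
    (hw : ∀ x, w (w x) = x) (hv : ∀ x, v (v x) = x) (c d e : X) (hd : d = v c) (he : e = w d)
    (hdc : d ≠ c) (hec : e ≠ c) (hde : e ≠ d) (hc : v c ≠ w c) (x : X)
    (hx : (swap c e * v * (swap c e)⁻¹) x ≠ w x) : v x ≠ w x ∧ x ≠ d ∧ x ≠ e := by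
  have hvd : v d = c := by rw [hd, hv]
  have hwe : w e = d := by rw [he, hw]
  have gv : ∀ x y z, swap c e x = y → swap c e (v x) = z →
      (swap c e * v * (swap c e)⁻¹) y = z := by
    rintro x y z rfl rfl; simp
  by_cases xd : x = d
  · refine absurd ?_ hx
    rw [xd]
    exact (gv d d e (swap_apply_of_ne_of_ne hdc hde.symm) (by rw [hvd, swap_apply_left])).trans he
  by_cases xe : x = e
  · refine absurd ?_ hx
    rw [xe]
    exact (gv c e d (swap_apply_left _ _)
      (by rw [← hd]; exact swap_apply_of_ne_of_ne hdc hde.symm)).trans hwe.symm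
  refine ⟨?_, xd, xe⟩
  by_cases xc : x = c
  · rw [xc]; exact hc
  by_cases xve : v x = e
  · rw [xve]; intro h; exact xd (by rw [← hwe, h, hw])
  rw [gv x x (v x) (swap_apply_of_ne_of_ne xc xe)
    (swap_apply_of_ne_of_ne (fun h => xd (by rw [← hv x, h, hd])) xve)] at hx
  exact hx

theorem aux_main {X : Type*} [Fintype X] [DecidableEq X] (w : Perm X) (p : X)
    (hw : ∀ x, w (w x) = x) (hwp : ∀ x, w x = x ↔ x = p) :
    ∀ (N : ℕ) (v τ : Perm X), (Finset.univ.filter fun x => v x ≠ w x).card ≤ N →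
      (∀ x, v (v x) = x) → (∀ x, v x = x ↔ x = p) → τ.IsCycle →
      (∀ x y, v x ≠ w x → v y ≠ w y → τ x ≠ x → τ y ≠ y → x = y) →
      (∃ b, τ b ≠ b ∧ τ (w b) = w b) →
      ∃ h : Perm X, h * v = w * h ∧ (h * τ).IsCycle ∧
        ∃ b, (h * τ) b ≠ b ∧ (h * τ) (w b) = w b := by
  intro N
  induction N with
  | zero =>
    intro v τ hN _ _ hτ _ hb
    have : v = w := by
      ext x
      by_contra hx
      rw [Nat.le_zero, Finset.card_eq_zero, Finset.filter_eq_empty_iff] at hN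
      exact hN (Finset.mem_univ x) hx
    exact ⟨1, by simp [this], by simpa using hτ, by simpa using hb⟩
  | succ N ih =>
    intro v τ hN hv hvp hτ hI hb
    -- reduction step
    have key : ∀ g : Perm X, (g * τ).IsCycle →
        (∀ x, (g * v * g⁻¹) x ≠ w x → v x ≠ w x) →
        (∃ x, v x ≠ w x ∧ (g * v * g⁻¹) x = w x) →
        g p = p →
        (∀ x y, (g * v * g⁻¹) x ≠ w x → (g * v * g⁻¹) y ≠ w y →
          (g * τ) x ≠ x → (g * τ) y ≠ y → x = y) →
        (∃ b, (g * τ) b ≠ b ∧ (g * τ) (w b) = w b) →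
        ∃ h : Perm X, h * v = w * h ∧ (h * τ).IsCycle ∧
          ∃ b, (h * τ) b ≠ b ∧ (h * τ) (w b) = w b := by
      intro g hg hsub hx hgp hI' hb'
      obtain ⟨h, h1, h2, h3⟩ := ih (g * v * g⁻¹) (g * τ) (by
        apply Nat.le_of_lt_succ
        refine lt_of_lt_of_le (Finset.card_lt_card ?_) hN
        obtain ⟨x, hx1, hx2⟩ := hx
        rw [Finset.ssubset_iff_of_subset]
        · exact ⟨x, Finset.mem_filter.2 ⟨Finset.mem_univ x, hx1⟩, fun h => (Finset.mem_filter.1 h).2 hx2⟩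
        · intro x hx
          simp only [Finset.mem_filter, Finset.mem_univ, true_and] at hx ⊢
          exact hsub x hx) (by intro x; simp [hv]) (by
          intro x
          simp only [Perm.mul_apply]
          rw [← Perm.eq_inv_iff_eq.trans Iff.rfl, hvp, Perm.inv_eq_iff_eq, hgp]) hg hI' hb'
      refine ⟨h * g, ?_, by simpa [mul_assoc] using h2, by simpa [mul_assoc] using h3⟩
      have := congrArg (· * g) h1
      simpa [mul_assoc] using this
    by_cases hB : ∃ c, v c ≠ w c ∧ τ c ≠ c
    · obtain ⟨c, hc, hcs⟩ := hB
      have hcp : c ≠ p := by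
        rintro rfl; exact hc (((hvp c).2 rfl).trans ((hwp c).2 rfl).symm)
      obtain ⟨d, hd⟩ : ∃ d, d = v c := ⟨_, rfl⟩
      obtain ⟨e, he⟩ : ∃ e, e = w d := ⟨_, rfl⟩
      have hdc : d ≠ c := by rw [hd]; exact fun h => hcp ((hvp c).1 h)
      have hvd : v d = c := by rw [hd, hv]
      have hwe : w e = d := by rw [he, hw]
      have hec : e ≠ c := by rintro rfl; exact hc (by rw [← hd, hwe])
      have hdp : d ≠ p := by rintro rfl; exact hdc (((hvp d).2 rfl).symm.trans hvd)
      have hde : e ≠ d := by rw [he]; exact fun h => hdp ((hwp d).1 h)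
      have hep : e ≠ p := by rintro rfl; exact hde (((hwp e).2 rfl).symm.trans hwe)
      have hbd : v d ≠ w d := by rw [hvd, ← he]; exact hec.symm
      have hbe : v e ≠ w e := by
        rw [hwe]; intro h; exact hec (by rw [← hv e, h, hvd])
      have hsd : τ d = d := by
        by_contra h; exact hdc (hI _ _ hbd hc h hcs)
      have hse : τ e = e := by
        by_contra h; exact hec (hI _ _ hbe hc h hcs)
      have hsub : ∀ x, (swap c e * v * (swap c e)⁻¹) x ≠ w x → v x ≠ w x ∧ x ≠ d ∧ x ≠ e :=
        aux_step w v hw hv c d e hd he hdc hec hde hc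
      have hsupp := aux_attach_supp τ hcs hse
      refine key (swap c e) (aux_attach τ hτ hcs hse) (fun x hx => (hsub x hx).1) ?_ ?_ ?_ ?_
      · refine ⟨d, hbd, ?_⟩
        by_contra h
        exact (hsub d h).2.1 rfl
      · exact swap_apply_of_ne_of_ne hcp.symm hep.symm
      · intro x y hx hy hx' hy'
        have hx2 := hsub x hx
        have hy2 := hsub y hy
        rw [hsupp] at hx' hy'
        exact hI x y hx2.1 hy2.1 (hx'.resolve_right hx2.2.2) (hy'.resolve_right hy2.2.2)
      · refine ⟨e, (hsupp e).2 (Or.inr rfl), ?_⟩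
        rw [hwe]
        by_contra h
        rcases (hsupp d).1 h with h | h
        · exact h hsd
        · exact hde h.symm
    · push Not at hB
      by_cases hE : ∃ a, v a ≠ w a
      · obtain ⟨a', ha'⟩ := hE
        obtain ⟨b, hbs, has⟩ := hb
        have hgood : v b = w b := by by_contra h; exact hbs (hB b h)
        obtain ⟨a, ha⟩ : ∃ a, a = w b := ⟨_, rfl⟩
        obtain ⟨b', hb'⟩ : ∃ b', b' = w a' := ⟨_, rfl⟩
        obtain ⟨c, hc⟩ : ∃ c, c = v a' := ⟨_, rfl⟩
        obtain ⟨d, hd⟩ : ∃ d, d = v b' := ⟨_, rfl⟩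
        rw [← ha] at has
        have hvp' := (hvp p).2 rfl
        have hwp' := (hwp p).2 rfl
        have hab : a ≠ b := by rintro rfl; exact hbs has
        have hwa : w a = b := by rw [ha, hw]
        have hva : v a = b := by rw [ha, ← hgood, hv]
        have hvb : v b = a := by rw [ha, ← hgood]
        have hwb' : w b' = a' := by rw [hb', hw]
        have hvc : v c = a' := by rw [hc, hv]
        have hvd : v d = b' := by rw [hd, hv]
        have hcb' : c ≠ b' := by rw [hc, hb']; exact ha'
        have ha'p : a' ≠ p := by rintro rfl; exact ha' (by rw [hvp', hwp'])
        have hbp : b ≠ p := by rintro rfl; exact hab (by rw [ha, hwp'])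
        have hap : a ≠ p := by rintro rfl; exact hab (by rw [← hwa, hwp'])
        have hb'p : b' ≠ p := by rintro rfl; exact ha'p (by rw [← hwb', hwp'])
        have hcp : c ≠ p := by rintro rfl; exact ha'p (by rw [← hvc, hvp'])
        have hca' : c ≠ a' := by rw [hc]; exact fun h => ha'p ((hvp _).1 h)
        have hba' : b' ≠ a' := by rw [hb']; exact fun h => ha'p ((hwp _).1 h)
        have h1 : a' ≠ a := by rintro rfl; exact ha' (by rw [hva, hwa])
        have h2 : a' ≠ b := by rintro rfl; exact ha' (by rw [hgood])
        have h3 : b' ≠ a := by rintro rfl; exact h2 (by rw [← hwb', hwa])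
        have h4 : b' ≠ b := by rintro rfl; exact h1 (by rw [← hwb', ha])
        have h5 : c ≠ a := by rintro rfl; exact h2 (by rw [← hvc, hva])
        have h6 : c ≠ b := by rintro rfl; exact h1 (by rw [← hvc, hvb])
        have hbb' : v b' ≠ w b' := by
          rw [hwb']; intro h; exact hcb' (by rw [hc, ← h, hv])
        have hbc : v c ≠ w c := by
          rw [hvc]; intro h; exact hcb' (by rw [hb', h, hw])
        have hwc : v (w c) ≠ w (w c) := by
          rw [hw]; intro h; exact hbc (by rw [← hv (w c), h])
        have hwcc : w c ≠ c := fun h => hcp ((hwp _).1 h)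
        have sa' := hB _ ha'
        have sb' := hB _ hbb'
        have sc := hB _ hbc
        have swc := hB _ hwc
        have hd1 : d ≠ b' := by rw [hd]; exact fun h => hb'p ((hvp _).1 h)
        have hbd : v d ≠ w d := by
          rw [hvd]; intro h; apply hbb'; rw [← hd, h, hw]
        obtain ⟨g, hg⟩ : ∃ g, g = swap b c * (swap b b' * (swap b a * swap b a')) := ⟨_, rfl⟩
        have ga' : g a' = a := by
          rw [hg]; simp only [Perm.mul_apply, swap_apply_def]; grind
        have ga : g a = b' := by
          rw [hg]; simp only [Perm.mul_apply, swap_apply_def]; grind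
        have gb' : g b' = c := by
          rw [hg]; simp only [Perm.mul_apply, swap_apply_def]; grind
        have gc : g c = b := by
          rw [hg]; simp only [Perm.mul_apply, swap_apply_def]; grind
        have gb : g b = a' := by
          rw [hg]; simp only [Perm.mul_apply, swap_apply_def]; grind
        have go : ∀ x, x ≠ a → x ≠ b → x ≠ a' → x ≠ b' → x ≠ c → g x = x := by
          intro x _ _ _ _ _
          rw [hg]; simp only [Perm.mul_apply, swap_apply_def]; grind
        have gv : ∀ x y z, g x = y → g (v x) = z → (g * v * g⁻¹) y = z := by
          rintro x y z rfl rfl; simp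
        -- attach the points one by one
        have c1 := aux_attach τ hτ hbs sa'
        have s1 := aux_attach_supp τ hbs sa'
        have n1 : (swap b a' * τ) b ≠ b := (s1 b).2 (Or.inl hbs)
        have m1 : (swap b a' * τ) a = a := by
          by_contra h; rcases (s1 a).1 h with h | h
          · exact h has
          · exact h1 h.symm
        have c2 := aux_attach _ c1 n1 m1
        have s2 := aux_attach_supp _ n1 m1
        have n2 := (s2 b).2 (Or.inl n1)
        have m2 : (swap b a * (swap b a' * τ)) b' = b' := by
          by_contra h; rw [← ne_eq, s2, s1] at h
          rcases h with (h | h) | h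
          · exact h sb'
          · exact hba' h
          · exact h3 h
        have c3 := aux_attach _ c2 n2 m2
        have s3 := aux_attach_supp _ n2 m2
        have n3 := (s3 b).2 (Or.inl n2)
        have m3 : (swap b b' * (swap b a * (swap b a' * τ))) c = c := by
          by_contra h; rw [← ne_eq, s3, s2, s1] at h
          rcases h with ((h | h) | h) | h
          · exact h sc
          · exact hca' h
          · exact h5 h
          · exact hcb' h
        have c4 := aux_attach _ c3 n3 m3
        have s4 := aux_attach_supp _ n3 m3
        have hgτ : swap b c * (swap b b' * (swap b a * (swap b a' * τ))) = g * τ := by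
          rw [hg]; simp only [mul_assoc]
        have hs : ∀ x, (g * τ) x ≠ x ↔ (((τ x ≠ x ∨ x = a') ∨ x = a) ∨ x = b') ∨ x = c := by
          intro x; rw [← hgτ, s4, s3, s2, s1]
        rw [hgτ] at c4
        have hsub : ∀ x, (g * v * g⁻¹) x ≠ w x → v x ≠ w x ∧ x ≠ a' ∧ x ≠ b' := by
          intro x hx
          by_cases xa' : x = a'
          · refine absurd ?_ hx
            rw [xa']; exact (gv b a' b' gb (by rw [hvb, ga])).trans hb'
          by_cases xb' : x = b'
          · refine absurd ?_ hx
            rw [xb']; exact (gv a b' a' ga (by rw [hva, gb])).trans hwb'.symm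
          refine ⟨?_, xa', xb'⟩
          by_cases xa : x = a
          · refine absurd ?_ hx
            rw [xa]; exact (gv a' a b ga' (by rw [← hc, gc])).trans hwa.symm
          by_cases xb : x = b
          · refine absurd ?_ hx
            rw [xb]; exact (gv c b a gc (by rw [hvc, ga'])).trans ha
          by_cases xc : x = c
          · rw [xc]; exact hbc
          by_cases xd : x = d
          · rw [xd]; exact hbd
          rw [gv x x (v x) (go x xa xb xa' xb' xc) (go (v x) _ _ _ _ _)] at hx
          · exact hx
          · intro h; exact xb (by rw [← hv x, h, hva])
          · intro h; exact xa (by rw [← hv x, h, hvb])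
          · intro h; exact xc (by rw [← hv x, h, hc])
          · intro h; exact xd (by rw [← hv x, h, hd])
          · intro h; exact xa' (by rw [← hv x, h, hvc])
        have hone : ∀ x, (g * v * g⁻¹) x ≠ w x → (g * τ) x ≠ x → x = c := by
          intro x hx hx'
          obtain ⟨q1, q2, q3⟩ := hsub x hx
          rw [hs] at hx'
          rcases hx' with (((h | h) | h) | h) | h
          · exact absurd (hB x q1) h
          · exact absurd h q2
          · exact absurd (by rw [h, hva, hwa]) q1
          · exact absurd h q3
          · exact h
        refine key g c4 (fun x hx => (hsub x hx).1) ⟨a', ha', ?_⟩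
          (go p hap.symm hbp.symm ha'p.symm hb'p.symm hcp.symm) ?_ ⟨c, (hs c).2 (Or.inr rfl), ?_⟩
        · by_contra h; exact (hsub a' h).2.1 rfl
        · intro x y hx hy hx' hy'
          rw [hone x hx hx', hone y hy hy']
        · by_contra h
          rw [← ne_eq, hs] at h
          rcases h with (((h | h) | h) | h) | h
          · exact h swc
          · exact hcb' (by rw [hb', ← h, hw])
          · exact h6 (by rw [← hwa, ← h, hw])
          · exact hca' (by rw [← hwb', ← h, hw])
          · exact hwcc h
      · push Not at hE
        have : v = w := Equiv.ext hE
        exact ⟨1, by simp [this], by simpa using hτ, by simpa using hb⟩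

/-- The maximality statement for the centralizer of `w` in the alternating group. -/
theorem aux_max {X : Type*} [Fintype X] [DecidableEq X] (w : Perm X) (p q : X) (hq : q ≠ p)
    (hw : ∀ x, w (w x) = x) (hwp : ∀ x, w x = x ↔ x = p) (σ : Perm X)
    (hσ : ¬ (sign σ = 1 ∧ σ * w = w * σ)) :
    ∃ g : Perm X, sign g = 1 ∧ g * w = w * g ∧ (g⁻¹ * σ).IsCycle := by
  have hsw : ∀ x, swap x (w x) * w = w * swap x (w x) := by
    intro x
    rw [Equiv.mul_swap_eq_swap_mul, hw, swap_comm]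
  -- it suffices to find a cycle with a half pair
  suffices H : σ * w ≠ w * σ → ∃ h : Perm X, h * w = w * h ∧ (h * σ).IsCycle ∧
      ∃ b, (h * σ) b ≠ b ∧ (h * σ) (w b) = w b by
    by_cases hc : σ * w = w * σ
    · have hs : sign σ = -1 := (Int.units_eq_one_or _).resolve_left fun h => hσ ⟨h, hc⟩
      have hqw : q ≠ w q := fun h => hq ((hwp q).1 h.symm)
      refine ⟨σ * swap q (w q), ?_, ?_, ?_⟩
      · rw [Perm.sign_mul, sign_swap hqw, hs]; rfl
      · rw [mul_assoc, hsw, ← mul_assoc, hc, mul_assoc]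
      · rw [mul_inv_rev, inv_mul_cancel_right, swap_inv]
        exact isCycle_swap hqw
    · obtain ⟨h, h1, h2, b, h3, h4⟩ := H hc
      have hinv : ∀ g : Perm X, g * w = w * g → g⁻¹ * w = w * g⁻¹ := by
        intro g hg
        rw [inv_mul_eq_iff_eq_mul, ← mul_assoc, hg, mul_inv_cancel_right]
      rcases Int.units_eq_one_or (sign h) with hs | hs
      · exact ⟨h⁻¹, by rw [sign_inv, hs], hinv h h1, by rwa [inv_inv]⟩
      · refine ⟨(swap b (w b) * h)⁻¹, ?_, hinv _ ?_, ?_⟩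
        · have hbw : b ≠ w b := by
            intro h; rw [← h] at h4; exact h3 h4
          rw [sign_inv, Perm.sign_mul, sign_swap hbw, hs]; rfl
        · rw [mul_assoc, h1, ← mul_assoc, hsw, mul_assoc]
        · rw [inv_inv, mul_assoc]
          exact aux_attach _ h2 h3 h4
  intro hne
  -- `u` is the pulled back involution
  obtain ⟨u, hu⟩ : ∃ u, u = σ⁻¹ * w * σ := ⟨_, rfl⟩
  have huu : ∀ x, u (u x) = x := by intro x; simp [hu, hw]
  have hup : ∀ x, u x = x ↔ σ x = p := by
    intro x
    rw [hu, ← hwp (σ x)]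
    simp only [Perm.mul_apply]
    rw [Perm.inv_eq_iff_eq]
  suffices H : ∃ τ : Perm X, τ * u = w * τ ∧ τ.IsCycle ∧ ∃ b, τ b ≠ b ∧ τ (w b) = w b by
    obtain ⟨τ, h1, h2, h3⟩ := H
    refine ⟨τ * σ⁻¹, ?_, by simpa using h2, by simpa using h3⟩
    have := congrArg (· * σ⁻¹) h1
    rw [hu] at this
    simpa [mul_assoc] using this
  have fin : ∀ s v : Perm X, v * s = s * u → (∀ x, v x = x ↔ x = p) → s.IsCycle →
      (∀ x y, v x ≠ w x → v y ≠ w y → s x ≠ x → s y ≠ y → x = y) →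
      (∃ b, s b ≠ b ∧ s (w b) = w b) →
      ∃ τ : Perm X, τ * u = w * τ ∧ τ.IsCycle ∧ ∃ b, τ b ≠ b ∧ τ (w b) = w b := by
    intro s v hvs hv hs h1 h2
    have hv' : v = s * u * s⁻¹ := by rw [← hvs, mul_inv_cancel_right]
    obtain ⟨h, k1, k2, k3⟩ := aux_main w p hw hwp _ v s le_rfl
      (by intro x; rw [hv']; simp [huu]) hv hs h1 h2
    refine ⟨h * s, ?_, k2, k3⟩
    rw [mul_assoc, ← hvs, ← mul_assoc, k1, mul_assoc]
  by_cases hσp : σ p = p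
  · have hup' : ∀ x, u x = x ↔ x = p := by
      intro x; rw [hup]
      exact ⟨fun h => σ.injective (h.trans hσp.symm), fun h => by rw [h, hσp]⟩
    obtain ⟨c, hc⟩ : ∃ c, u c ≠ w c := by
      by_contra h
      push Not at h
      apply hne
      have : u = w := Equiv.ext h
      rw [hu, mul_assoc, inv_mul_eq_iff_eq_mul] at this
      exact this.symm
    have hcp : c ≠ p := by
      rintro rfl; exact hc (((hup' c).2 rfl).trans ((hwp c).2 rfl).symm)
    obtain ⟨d, hd⟩ : ∃ d, d = u c := ⟨_, rfl⟩
    obtain ⟨e, he⟩ : ∃ e, e = w d := ⟨_, rfl⟩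
    have hdc : d ≠ c := by rw [hd]; exact fun h => hcp ((hup' c).1 h)
    have hvd : u d = c := by rw [hd, huu]
    have hwe : w e = d := by rw [he, hw]
    have hec : e ≠ c := by rintro rfl; exact hc (by rw [← hd, hwe])
    have hdp : d ≠ p := by rintro rfl; exact hdc (((hup' d).2 rfl).symm.trans hvd)
    have hde : e ≠ d := by rw [he]; exact fun h => hdp ((hwp d).1 h)
    have hep : e ≠ p := by rintro rfl; exact hde (((hwp e).2 rfl).symm.trans hwe)
    have hsub := aux_step w u hw huu c d e hd he hdc hec hde hc
    have hsp : swap c e p = p := swap_apply_of_ne_of_ne hcp.symm hep.symm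
    have hone : ∀ x, (swap c e * u * (swap c e)⁻¹) x ≠ w x → swap c e x ≠ x → x = c := by
      intro x hx hx'
      by_contra h
      exact hx' (swap_apply_of_ne_of_ne h (hsub x hx).2.2)
    refine fin (swap c e) (swap c e * u * (swap c e)⁻¹) (inv_mul_cancel_right _ _) ?_
      (isCycle_swap hec.symm) ?_ ?_
    · intro x
      rw [Perm.mul_apply, Perm.mul_apply, ← Perm.eq_inv_iff_eq, hup', Perm.inv_eq_iff_eq, hsp]
    · intro x y hx hy hx' hy'
      rw [hone x hx hx', hone y hy hy']
    · refine ⟨e, by rw [swap_apply_right]; exact hec.symm, ?_⟩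
      rw [hwe]
      exact swap_apply_of_ne_of_ne hdc hde.symm
  · obtain ⟨r, hr⟩ : ∃ r, r = σ⁻¹ p := ⟨_, rfl⟩
    have hσr : σ r = p := by rw [hr]; simp
    have hrp : r ≠ p := by rintro rfl; exact hσp hσr
    have hur : u r = r := (hup r).2 hσr
    refine fin (swap r p) (swap r p * u * (swap r p)⁻¹) (by simp) ?_ (isCycle_swap hrp) ?_ ?_
    · intro x
      rw [Perm.mul_apply, Perm.mul_apply, ← Perm.eq_inv_iff_eq, hup, ← hσr,
        σ.injective.eq_iff, Perm.inv_eq_iff_eq, swap_apply_left, hσr]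
    · have hone : ∀ x, (swap r p * u * (swap r p)⁻¹) x ≠ w x → swap r p x ≠ x → x = r := by
        intro x hx hx'
        by_contra h
        apply hx'
        apply swap_apply_of_ne_of_ne h
        rintro rfl
        apply hx
        simp [hur, (hwp x).2 rfl]
      intro x y hx hy hx' hy'
      rw [hone x hx hx', hone y hy hy']
    · refine ⟨r, by simpa using hrp.symm, ?_⟩
      apply swap_apply_of_ne_of_ne
      · exact fun h => hrp ((hwp r).1 h)
      · exact fun h => hrp (by rw [← hw r, h, (hwp p).2 rfl])

theorem aux_indep {X : Type*} [Fintype X] [DecidableEq X] (w : Perm X) (p : X)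
    (hw : ∀ x, w (w x) = x) (hwp : ∀ x, w x = x ↔ x = p) (σ : Perm X)
    (hs : sign σ = 1) (hc : σ * w = w * σ) : ¬ σ.IsCycle := by
  intro h
  have hc' : ∀ x, σ (w x) = w (σ x) := fun x => Perm.congr_fun hc x
  have hp : σ p = p := by
    rw [← hwp, ← hc', (hwp p).2 rfl]
  have h0 : ∑ x ∈ σ.support, (1 : ZMod 2) = 0 := by
    apply Finset.sum_involution (fun x _ => w x)
    · intros; decide
    · intro x hx _ hx'
      rw [hwp] at hx'
      rw [mem_support, hx'] at hx
      exact hx hp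
    · intro x hx
      rw [mem_support] at hx ⊢
      rw [hc']
      exact fun h => hx (w.injective h)
    · intro x _; exact hw x
  rw [Finset.sum_const, nsmul_one, ZMod.natCast_eq_zero_iff_even] at h0
  rw [h.sign, h0.neg_one_pow] at hs
  exact absurd hs (by decide)

end Aux

/-- The pairing involution, extended to fix the last point. -/
def extSwap (k : ℕ) : Equiv.Perm (Fin (k + k + 1)) := permOplus (permBlockSwap k) 1

theorem permOplus_castAdd {a b : ℕ} (x : Equiv.Perm (Fin a)) (y : Equiv.Perm (Fin b)) (i : Fin a) :
    permOplus x y (Fin.castAdd b i) = Fin.castAdd b (x i) := by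
  simp [permOplus]

theorem permOplus_natAdd {a b : ℕ} (x : Equiv.Perm (Fin a)) (y : Equiv.Perm (Fin b)) (i : Fin b) :
    permOplus x y (Fin.natAdd a i) = Fin.natAdd a (y i) := by
  simp [permOplus]

theorem permOplus_sign {a b : ℕ} (x : Equiv.Perm (Fin a)) (y : Equiv.Perm (Fin b)) :
    Equiv.Perm.sign (permOplus x y) = Equiv.Perm.sign x * Equiv.Perm.sign y := by
  rw [← Equiv.Perm.sign_sumCongr]
  exact Equiv.Perm.sign_permCongr finSumFinEquiv (Equiv.sumCongr x y)

theorem blockSwap_invol (k : ℕ) (j : Fin (k + k)) : permBlockSwap k (permBlockSwap k j) = j := by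
  simp [permBlockSwap]

theorem blockSwap_ne (k : ℕ) (j : Fin (k + k)) : permBlockSwap k j ≠ j := by
  intro h
  rw [permBlockSwap, Equiv.trans_apply, Equiv.trans_apply, ← Equiv.eq_symm_apply] at h
  rcases hs : finSumFinEquiv.symm j with s | s <;> rw [hs] at h <;> simp at h

theorem extSwap_invol (k : ℕ) (x : Fin (k + k + 1)) : extSwap k (extSwap k x) = x := by
  refine Fin.addCases (fun i => ?_) (fun i => ?_) x
  · rw [extSwap, permOplus_castAdd, permOplus_castAdd, blockSwap_invol]
  · rw [extSwap, permOplus_natAdd, permOplus_natAdd]; rfl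

theorem extSwap_fix (k : ℕ) (x : Fin (k + k + 1)) :
    extSwap k x = x ↔ x = Fin.natAdd (k + k) (0 : Fin 1) := by
  refine Fin.addCases (fun i => ?_) (fun i => ?_) x
  · rw [extSwap, permOplus_castAdd]
    constructor
    · intro h; exact absurd (Fin.castAdd_injective _ _ h) (blockSwap_ne k i)
    · intro h
      have := congrArg Fin.val h
      have := i.2
      simp at *
      omega
  · rw [extSwap, permOplus_natAdd]
    simp [Subsingleton.elim i 0]

theorem mem_GsetExt (k : ℕ) (σ : Equiv.Perm (Fin (k + k + 1))) :
    σ ∈ GsetExt k ↔ Equiv.Perm.sign σ = 1 ∧ σ * extSwap k = extSwap k * σ := by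
  constructor
  · rintro ⟨τ, ⟨h1, h2⟩, rfl⟩
    refine ⟨?_, ?_⟩
    · simp [permOplus_sign, Equiv.Perm.mem_alternatingGroup.1 h1]
    · ext1 x
      refine Fin.addCases (fun i => ?_) (fun i => ?_) x
      · simp only [Equiv.Perm.mul_apply, extSwap, permOplus_castAdd, h2]
      · simp only [Equiv.Perm.mul_apply, extSwap, permOplus_natAdd, Equiv.Perm.one_apply]
  · rintro ⟨h1, h2⟩
    have hc : ∀ x, σ (extSwap k x) = extSwap k (σ x) := fun x => Equiv.Perm.congr_fun h2 x
    have hp : σ (Fin.natAdd (k + k) (0 : Fin 1)) = Fin.natAdd (k + k) (0 : Fin 1) := by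
      rw [← extSwap_fix, ← hc, (extSwap_fix k _).2 rfl]
    obtain ⟨⟨x, y⟩, hxy⟩ := Equiv.Perm.mem_sumCongrHom_range_of_perm_mapsTo_inl
      (σ := finSumFinEquiv.symm.permCongr σ) (by
        rintro _ ⟨i, rfl⟩
        obtain ⟨s, hs⟩ : ∃ s, s = finSumFinEquiv.symm.permCongr σ (Sum.inl i) := ⟨_, rfl⟩
        rw [← hs]
        rcases s with s | s
        · exact ⟨s, rfl⟩
        · exfalso
          have h3 : finSumFinEquiv (Sum.inr s) = σ (Fin.castAdd 1 i) := by
            rw [hs]; simp [Equiv.permCongr_apply]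
          rw [finSumFinEquiv_apply_right, Subsingleton.elim s 0, ← hp] at h3
          have := congrArg Fin.val (σ.injective h3)
          have := i.2
          simp at *
          omega)
    have hσ : σ = permOplus x 1 := by
      rw [Subsingleton.elim 1 y]
      have := congrArg finSumFinEquiv.permCongr hxy
      ext1 z
      have := Equiv.Perm.congr_fun this z
      simpa [permOplus, Equiv.permCongr_apply] using this.symm
    refine ⟨x, ⟨?_, ?_⟩, hσ.symm⟩
    · rw [Equiv.Perm.mem_alternatingGroup]
      rw [hσ, permOplus_sign] at h1
      simpa using h1
    · intro j
      have := hc (Fin.castAdd 1 j)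
      rw [hσ] at this
      simp only [extSwap, permOplus_castAdd] at this
      exact Fin.castAdd_injective _ _ this

/-- Theorem 3.5: for `n = 2k ≥ 4`, `Gₙ`, viewed as a set of permutations of `n + 1`
points fixing the last point, is a maximal independent set of `G(Ω_{n+1})`. -/
theorem stmt10 (k : ℕ) (hk : 2 ≤ k) :
    IsBIndep (GsetExt k) ∧
    (∀ σ : Equiv.Perm (Fin (k + k + 1)), σ ∉ GsetExt k →
      ¬ IsBIndep (insert σ (GsetExt k))) := by
  constructor
  · intro σ hσ τ hτ _
    rw [mem_GsetExt] at hσ hτ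
    refine aux_indep (extSwap k) _ (extSwap_invol k) (extSwap_fix k) _ ?_ ?_
    · rw [Equiv.Perm.sign_mul, Equiv.Perm.sign_inv, hσ.1, hτ.1, one_mul]
    · rw [mul_assoc, hτ.2, ← mul_assoc, ← mul_assoc]
      congr 1
      rw [inv_mul_eq_iff_eq_mul, ← mul_assoc, hσ.2, mul_inv_cancel_right]
  · intro σ hσ hI
    have hσ' := hσ
    rw [mem_GsetExt] at hσ'
    obtain ⟨g, h1, h2, h3⟩ := aux_max (extSwap k) (Fin.natAdd (k + k) (0 : Fin 1))
      (Fin.castAdd 1 ⟨0, by omega⟩) (by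
        intro h
        have := congrArg Fin.val h
        simp at this
        omega) (extSwap_invol k) (extSwap_fix k) σ hσ'
    have hg : g ∈ GsetExt k := (mem_GsetExt k g).2 ⟨h1, h2⟩
    refine hI (Set.mem_insert_of_mem _ hg) (Set.mem_insert _ _) ?_ h3
    rintro rfl
    exact hσ hg
end

section
/- Let n ≥ 4 be an integer and write n = 2^m + q with 0 ≤ q < 2^m (so m = ⌊log₂ n⌋). Define g(n) = 2^{m−1}·∏_{i=1}^{m} ⌊n/2^i⌋! if 0 ≤ q < 2^{m−1}, and g(n) = 2^{m}·∏_{i=1}^{m} ⌊n/2^i⌋! if 2^{m−1} ≤ q < 2^m. Then the independence number α(n) of the Birkhoff polytope graph G(Ω_n) satisfies α(n) ≥ g(n); moreover, there exists an independent set of G(Ω_n) of size g(n) all of whose elements are even permutations. -/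
/-- There is an independent set of `s` even permutations of `α`. -/
def HasEvenIndep (α : Type) [Fintype α] [DecidableEq α] (s : ℕ) : Prop :=
  ∃ S : Finset (Equiv.Perm α),
    ((S : Set (Equiv.Perm α)).Pairwise fun σ τ => ¬ (σ⁻¹ * τ).IsCycle) ∧
      (∀ σ ∈ S, Equiv.Perm.sign σ = 1) ∧ S.card = s

lemma isCycle_of_extendDomain {α β : Type} [Fintype α] [DecidableEq α] [Fintype β]
    [DecidableEq β] {p : β → Prop} [DecidablePred p] (f : α ≃ Subtype p) (g : Equiv.Perm α)
    (h : (g.extendDomain f).IsCycle) : g.IsCycle := by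
  rw [← Equiv.Perm.card_cycleType_eq_one] at h ⊢
  rwa [Equiv.Perm.cycleType_extendDomain] at h

lemma HasEvenIndep.embed {α β : Type} [Fintype α] [DecidableEq α] [Fintype β]
    [DecidableEq β] (f : α ↪ β) {s : ℕ} (h : HasEvenIndep α s) : HasEvenIndep β s := by
  classical
  obtain ⟨S, h1, h2, h3⟩ := h
  let e := Equiv.ofInjective f f.injective
  refine ⟨S.image (Equiv.Perm.extendDomainHom e), ?_, ?_, ?_⟩
  · intro a ha b hb hab
    simp only [Finset.coe_image, Set.mem_image, Finset.mem_coe] at ha hb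
    obtain ⟨a, ha, rfl⟩ := ha
    obtain ⟨b, hb, rfl⟩ := hb
    rw [← map_inv, ← map_mul]
    intro hc
    exact h1 ha hb (fun h => hab (by rw [h])) (isCycle_of_extendDomain e _ hc)
  · intro a ha
    simp only [Finset.mem_image] at ha
    obtain ⟨a, ha, rfl⟩ := ha
    simp only [Equiv.Perm.extendDomainHom_apply, Equiv.Perm.sign_extendDomain]
    exact h2 a ha
  · rw [Finset.card_image_of_injective _ (Equiv.Perm.extendDomainHom_injective e), h3]

lemma hasEvenIndep_one (α : Type) [Fintype α] [DecidableEq α] : HasEvenIndep α 1 :=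
  ⟨{1}, by simp, by simp, by simp⟩

lemma sumCongr_isCycle {α β : Type} {a : Equiv.Perm α} {b : Equiv.Perm β}
    (h : (Equiv.Perm.sumCongr a b).IsCycle) : (a = 1 ∧ b.IsCycle) ∨ (b = 1 ∧ a.IsCycle) := by
  have key : ∀ i : ℤ, (Equiv.Perm.sumCongr a b) ^ i = Equiv.Perm.sumCongr (a ^ i) (b ^ i) := by
    intro i
    have := map_zpow (Equiv.Perm.sumCongrHom α β) (a, b) i
    simpa using this.symm
  by_cases ha : a = 1
  · left
    refine ⟨ha, ?_⟩
    obtain ⟨x, hx, hy⟩ := h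
    rcases x with x | x
    · simp [ha] at hx
    · refine ⟨x, by simpa using hx, fun y hyy => ?_⟩
      obtain ⟨i, hi⟩ := hy (y := Sum.inr y) (by simpa using hyy)
      rw [key] at hi
      exact ⟨i, by simpa using hi⟩
  · right
    obtain ⟨z, hz⟩ : ∃ z, a z ≠ z := by
      by_contra! hh
      exact ha (Equiv.ext hh)
    have hz' : Equiv.Perm.sumCongr a b (Sum.inl z) ≠ Sum.inl z := by simpa using hz
    constructor
    · ext y
      by_contra hy
      obtain ⟨i, hi⟩ := h.sameCycle hz' (y := Sum.inr y) (by simpa using hy)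
      rw [key] at hi
      simp at hi
    · refine ⟨z, hz, fun y hyy => ?_⟩
      obtain ⟨i, hi⟩ := h.sameCycle hz' (y := Sum.inl y) (by simpa using hyy)
      rw [key] at hi
      exact ⟨i, by simpa using hi⟩

lemma exists_even_swapper (α : Type) [Fintype α] [DecidableEq α] [Nontrivial α] :
    ∃ u : Equiv.Perm (α ⊕ α), Equiv.Perm.sign u = 1 ∧ ∀ x, (u x).isLeft = !x.isLeft := by
  rcases Int.units_eq_one_or (Equiv.Perm.sign (Equiv.sumComm α α)) with h | h
  · exact ⟨Equiv.sumComm α α, h, by rintro (x | x) <;> rfl⟩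
  · obtain ⟨a, b, hab⟩ := exists_pair_ne α
    refine ⟨Equiv.sumComm α α * Equiv.Perm.sumCongr (Equiv.swap a b) 1, ?_, ?_⟩
    · rw [Equiv.Perm.sign_mul, h, Equiv.Perm.sign_sumCongr, Equiv.Perm.sign_swap hab]
      simp
    · rintro (x | x) <;> rfl

lemma not_isCycle_of_swapper {α : Type} [Fintype α] [DecidableEq α]
    (u : Equiv.Perm (α ⊕ α)) (hs : Equiv.Perm.sign u = 1)
    (hu : ∀ x, (u x).isLeft = !x.isLeft) : ¬ u.IsCycle := by
  intro hc
  have h1 : u.support = Finset.univ := by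
    ext x
    simp only [Equiv.Perm.mem_support, Finset.mem_univ, iff_true]
    intro h
    have := hu x
    rw [h] at this
    cases hx : x.isLeft <;> simp [hx] at this
  have h2 := hc.sign
  rw [hs, h1, Finset.card_univ, Fintype.card_sum, ← two_mul, pow_mul] at h2
  simp at h2

lemma HasEvenIndep.double {α : Type} [Fintype α] [DecidableEq α] [Nontrivial α] {s : ℕ}
    (h : HasEvenIndep α s) :
    HasEvenIndep (α ⊕ α) (2 * (Fintype.card α).factorial * s) := by
  classical
  obtain ⟨T, h1, h2, h3⟩ := h
  obtain ⟨u, hu1, hu2⟩ := exists_even_swapper α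
  let F : Equiv.Perm α × Equiv.Perm α → Equiv.Perm (α ⊕ α) :=
    fun p => Equiv.Perm.sumCongr p.1 (p.1 * p.2)
  have hF : Function.Injective F := by
    rintro ⟨a, b⟩ ⟨c, d⟩ h
    have := Equiv.Perm.sumCongrHom_injective (α := α) (β := α)
      (a₁ := (a, a * b)) (a₂ := (c, c * d)) h
    simp only [Prod.mk.injEq] at this
    obtain ⟨rfl, h⟩ := this
    simpa using h
  have hFl : ∀ p x, (F p x).isLeft = x.isLeft := by
    rintro p (x | x) <;> rfl
  have hFl' : ∀ p x, ((F p)⁻¹ x).isLeft = x.isLeft := by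
    rintro p (x | x) <;> rfl
  let A : Finset (Equiv.Perm (α ⊕ α)) := (Finset.univ ×ˢ T).image F
  have hA : ∀ x ∈ A, ∃ p, p.2 ∈ T ∧ F p = x := by
    intro x hx
    simpa [A] using hx
  have hAs : ∀ x ∈ A, Equiv.Perm.sign x = 1 := by
    intro x hx
    obtain ⟨p, hp, rfl⟩ := hA x hx
    simp only [F, Equiv.Perm.sign_sumCongr, Equiv.Perm.sign_mul, h2 _ hp, mul_one,
      Int.units_mul_self]
  have hAi : ∀ x ∈ A, ∀ y ∈ A, x ≠ y → ¬ (x⁻¹ * y).IsCycle := by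
    intro x hx y hy hxy hc
    obtain ⟨⟨a, b⟩, hp, rfl⟩ := hA x hx
    obtain ⟨⟨c, d⟩, hr, rfl⟩ := hA y hy
    simp only [F, Equiv.Perm.sumCongr_inv, Equiv.Perm.sumCongr_mul] at hc
    rcases sumCongr_isCycle hc with ⟨h, h'⟩ | ⟨h, h'⟩
    · have hac : a = c := inv_mul_eq_one.mp h
      subst hac
      have hbd : b ≠ d := fun h => hxy (by rw [h])
      refine h1 hp hr hbd ?_
      simpa [mul_assoc] using h'
    · have hab : a * b = c * d := inv_mul_eq_one.mp h
      have hbd : d ≠ b := by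
        rintro rfl
        exact hxy (by rw [mul_right_cancel hab])
      refine h1 hr hp hbd ?_
      have e : a⁻¹ * c = b * (d⁻¹ * b) * b⁻¹ := by
        have : c = a * b * d⁻¹ := by rw [hab]; group
        rw [this]; group
      rw [e] at h'
      have := h'.conj (g := b⁻¹)
      simpa [mul_assoc] using this
  have hcr : ∀ x ∈ A, ∀ y ∈ A, ¬ (x⁻¹ * (y * u)).IsCycle := by
    intro x hx y hy
    apply not_isCycle_of_swapper
    · simp [Equiv.Perm.sign_mul, hAs x hx, hAs y hy, hu1]
    · intro z
      obtain ⟨p, -, rfl⟩ := hA x hx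
      obtain ⟨r, -, rfl⟩ := hA y hy
      simp only [Equiv.Perm.mul_apply, hFl', hFl, hu2]
  have hinj : Function.Injective (fun x : Equiv.Perm (α ⊕ α) => x * u) := mul_left_injective u
  refine ⟨A ∪ A.image (fun x => x * u), ?_, ?_, ?_⟩
  · intro x hx y hy hxy
    simp only [Finset.coe_union, Finset.coe_image, Set.mem_union, Finset.mem_coe,
      Set.mem_image] at hx hy
    rcases hx with hx | ⟨x, hx, rfl⟩ <;> rcases hy with hy | ⟨y, hy, rfl⟩
    · exact hAi x hx y hy hxy
    · exact hcr x hx y hy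
    · intro hc
      apply hcr y hy x hx
      have := hc.inv
      simpa [mul_assoc] using this
    · intro hc
      apply hAi x hx y hy (fun h => hxy (by rw [h]))
      have := hc.conj (g := u)
      simpa [mul_assoc] using this
  · intro x hx
    simp only [Finset.mem_union, Finset.mem_image] at hx
    rcases hx with hx | ⟨x, hx, rfl⟩
    · exact hAs x hx
    · simp [Equiv.Perm.sign_mul, hAs x hx, hu1]
  · rw [Finset.card_union_of_disjoint, Finset.card_image_of_injective _ hinj,
      Finset.card_image_of_injective _ hF, Finset.card_product, h3, Finset.card_univ,
      Fintype.card_perm]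
    · ring
    · rw [Finset.disjoint_left]
      intro x hx hx'
      simp only [Finset.mem_image] at hx'
      obtain ⟨y, hy, rfl⟩ := hx'
      obtain ⟨a, b, -⟩ := exists_pair_ne α
      obtain ⟨p, -, hp⟩ := hA _ hx
      obtain ⟨r, -, hr⟩ := hA _ hy
      have e1 := hFl p (Sum.inl a)
      rw [hp, ← hr] at e1
      simp [Equiv.Perm.mul_apply, hFl, hu2] at e1

lemma HasEvenIndep.step {k n s : ℕ} (hk : 2 ≤ k) (hn : n / 2 = k)
    (h : HasEvenIndep (Fin k) s) : HasEvenIndep (Fin n) (2 * k.factorial * s) := by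
  have : Nontrivial (Fin k) := Fin.nontrivial_iff_two_le.mpr hk
  have h2 := h.double
  rw [Fintype.card_fin] at h2
  exact h2.embed (finSumFinEquiv.toEmbedding.trans (Fin.castLEEmb (by omega)))

/-- Action of `Sym(4)` on the six 2-element subsets. -/
def pairAction (σ : Equiv.Perm (Fin 4)) : Equiv.Perm {s : Finset (Fin 4) // s.card = 2} :=
  Equiv.Perm.subtypePerm (Equiv.finsetCongr σ) (by simp)

lemma pairAction_sign (σ : Equiv.Perm (Fin 4)) : Equiv.Perm.sign (pairAction σ) = 1 := by
  revert σ
  decide +kernel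

lemma pairAction_aux : ∀ σ : Equiv.Perm (Fin 4), σ ≠ 1 →
    ∃ x y, pairAction σ x ≠ x ∧ pairAction σ y ≠ y ∧
      ∀ i : Fin 6, (pairAction σ ^ (i : ℕ)) x ≠ y := by
  decide +kernel

lemma pairAction_mul (σ τ : Equiv.Perm (Fin 4)) :
    pairAction (σ * τ) = pairAction σ * pairAction τ := by
  apply Equiv.ext
  rintro ⟨s, hs⟩
  apply Subtype.ext
  simp only [pairAction, Equiv.Perm.mul_apply, Equiv.Perm.subtypePerm_apply,
    Equiv.finsetCongr_apply, Finset.map_map]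
  rfl

lemma pairAction_one : pairAction 1 = 1 := by
  have h := pairAction_mul 1 1
  rw [one_mul] at h
  exact (left_eq_mul.mp h)

lemma pairAction_not_isCycle (σ : Equiv.Perm (Fin 4)) (hσ : σ ≠ 1) :
    ¬ (pairAction σ).IsCycle := by
  intro hc
  obtain ⟨x, y, hx, hy, hxy⟩ := pairAction_aux σ hσ
  obtain ⟨i, hi, hi'⟩ := (hc.sameCycle hx hy).exists_pow_eq'
  have hcard : Fintype.card {s : Finset (Fin 4) // s.card = 2} = 6 := by
    rw [Fintype.card_finset_len]
    rfl
  have := Finset.card_le_univ (pairAction σ).support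
  rw [← hc.orderOf] at this
  exact hxy ⟨i, by omega⟩ hi'

lemma pairAction_injective : Function.Injective pairAction := by
  intro σ τ h
  by_contra hne
  have h1 : σ⁻¹ * τ ≠ 1 := fun h => hne (inv_mul_eq_one.mp h)
  obtain ⟨x, y, hx, -, -⟩ := pairAction_aux _ h1
  apply hx
  rw [pairAction_mul, ← h, ← pairAction_mul, inv_mul_cancel, pairAction_one]
  rfl

lemma hasEvenIndep_six : HasEvenIndep (Fin 6) 24 := by
  have h : HasEvenIndep {s : Finset (Fin 4) // s.card = 2} 24 := by
    refine ⟨Finset.univ.image pairAction, ?_, ?_, ?_⟩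
    · intro a ha b hb hab
      simp only [Finset.coe_image, Set.mem_image, Finset.mem_coe] at ha hb
      obtain ⟨σ, -, rfl⟩ := ha
      obtain ⟨τ, -, rfl⟩ := hb
      have e : (pairAction σ)⁻¹ = pairAction σ⁻¹ := by
        rw [inv_eq_iff_mul_eq_one, ← pairAction_mul, mul_inv_cancel, pairAction_one]
      rw [e, ← pairAction_mul]
      apply pairAction_not_isCycle
      intro h
      exact hab (by rw [inv_mul_eq_one.mp h])
    · intro a ha
      simp only [Finset.mem_image] at ha
      obtain ⟨σ, -, rfl⟩ := ha
      exact pairAction_sign σ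
    · rw [Finset.card_image_of_injective _ pairAction_injective, Finset.card_univ,
        Fintype.card_perm, Fintype.card_fin]
      rfl
  have hcard : Fintype.card {s : Finset (Fin 4) // s.card = 2} = 6 := by
    rw [Fintype.card_finset_len]
    rfl
  exact h.embed (Fintype.equivFinOfCardEq hcard).toEmbedding

lemma prod_Icc_shift (f : ℕ → ℕ) (t : ℕ) :
    ∏ i ∈ Finset.Icc 1 (t + 1), f i = f 1 * ∏ i ∈ Finset.Icc 1 t, f (i + 1) := by
  induction t with
  | zero => simp
  | succ t ih =>
    rw [Finset.prod_Icc_succ_top (by omega), ih, Finset.prod_Icc_succ_top (by omega), mul_assoc]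

lemma hasEvenIndep_main (m : ℕ) : ∀ n q : ℕ, n = 2 ^ (m + 2) + q → q < 2 ^ (m + 2) →
    HasEvenIndep (Fin n) (if q < 2 ^ (m + 1)
      then 2 ^ (m + 1) * ∏ i ∈ Finset.Icc 1 (m + 2), (n / 2 ^ i).factorial
      else 2 ^ (m + 2) * ∏ i ∈ Finset.Icc 1 (m + 2), (n / 2 ^ i).factorial) := by
  induction m with
  | zero =>
    intro n q hn hq
    have h2 : HasEvenIndep (Fin 2) 1 := hasEvenIndep_one _
    have h6 := hasEvenIndep_six
    norm_num at hn hq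
    interval_cases q <;> subst hn
    · exact h2.step le_rfl rfl
    · exact h2.step le_rfl rfl
    · exact h6
    · exact h6.embed (Fin.castLEEmb (by omega))
  | succ m ih =>
    intro n q hn hq
    have e2 : 2 ^ (m + 1 + 2) = 2 * 2 ^ (m + 2) := by ring
    have e1 : 2 ^ (m + 1 + 1) = 2 * 2 ^ (m + 1) := by ring
    have e3 : 2 ^ (m + 2) = 2 * 2 ^ (m + 1) := by ring
    have hpos : 1 ≤ 2 ^ (m + 1) := Nat.one_le_two_pow
    have h := (ih (n / 2) (q / 2) (by omega) (by omega)).step (n := n) (by omega) rfl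
    have hprod : ∏ i ∈ Finset.Icc 1 (m + 1 + 2), (n / 2 ^ i).factorial =
        (n / 2).factorial * ∏ i ∈ Finset.Icc 1 (m + 2), (n / 2 / 2 ^ i).factorial := by
      rw [prod_Icc_shift, pow_one]
      congr 1
      refine Finset.prod_congr rfl fun i _ => ?_
      rw [Nat.div_div_eq_div_mul, pow_succ']
    rw [hprod]
    convert h using 1
    by_cases hc : q / 2 < 2 ^ (m + 1)
    · rw [if_pos hc, if_pos (by omega), e1]
      ring
    · rw [if_neg hc, if_neg (by omega), e2]
      ring

/-- Theorem 4.1: for `n = 2^m + q ≥ 4` with `0 ≤ q < 2^m`, we have `α(n) ≥ g(n)` where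
`g(n) = 2^(m-1)·∏_{i=1}^m ⌊n/2^i⌋!` if `q < 2^(m-1)` and `g(n) = 2^m·∏_{i=1}^m ⌊n/2^i⌋!`
otherwise; moreover there is an independent set of even permutations of size `g(n)`. -/
theorem stmt11 (n m q : ℕ) (hn : 4 ≤ n) (hnq : n = 2 ^ m + q) (hq : q < 2 ^ m)
    (g : ℕ)
    (hg : g = if q < 2 ^ (m - 1)
      then 2 ^ (m - 1) * ∏ i ∈ Finset.Icc 1 m, (n / 2 ^ i).factorial
      else 2 ^ m * ∏ i ∈ Finset.Icc 1 m, (n / 2 ^ i).factorial) :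
    g ≤ birkhoffIndepNum n ∧
    ∃ S : Finset (Equiv.Perm (Fin n)), IsBIndep (S : Set (Equiv.Perm (Fin n))) ∧
      (∀ σ ∈ S, Equiv.Perm.sign σ = 1) ∧ S.card = g := by
  obtain ⟨k, rfl⟩ : ∃ k, m = k + 2 := by
    rcases m with _ | _ | m
    · norm_num at hnq hq; omega
    · norm_num at hnq hq; omega
    · exact ⟨m, rfl⟩
  have hmain := hasEvenIndep_main k n q hnq hq
  have e : k + 2 - 1 = k + 1 := by omega
  rw [e] at hg
  rw [← hg] at hmain
  obtain ⟨S, h1, h2, h3⟩ := hmain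
  refine ⟨?_, S, h1, h2, h3⟩
  apply le_csSup
  · refine ⟨Fintype.card (Equiv.Perm (Fin n)), ?_⟩
    rintro _ ⟨T, -, rfl⟩
    exact Finset.card_le_univ T
  · exact ⟨S, h1, h3⟩
end

section
/- Let n ≥ 4 be an integer and write n = 2^m + q with 0 ≤ q < 2^m. Then the independence number α(n) of the Birkhoff polytope graph G(Ω_n) satisfies α(n) ≥ q! · 2^{m−1} · ∏_{i=1}^{m−1} (2^i)!. -/
open Equiv Equiv.Perm

/-- `S` is an independent set in the symmetric group on `A`. -/
def GoodSet (A : Type) (S : Finset (Perm A)) : Prop :=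
  ∀ x ∈ S, ∀ y ∈ S, x ≠ y → ¬ (x⁻¹ * y).IsCycle

lemma sumCongr_cycle {A B : Type} (a : Perm A) (b : Perm B)
    (h : (Equiv.Perm.sumCongr a b).IsCycle) :
    (a = 1 ∧ b.IsCycle) ∨ (a.IsCycle ∧ b = 1) := by
  have hp : ∀ i : ℤ, (Equiv.Perm.sumCongr a b) ^ i = Equiv.Perm.sumCongr (a ^ i) (b ^ i) := by
    intro i
    exact (map_zpow (Equiv.Perm.sumCongrHom A B) (a, b) i).symm
  obtain ⟨x, hx, hy⟩ := h
  rcases x with x | x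
  · right
    refine ⟨⟨x, by simpa using hx, fun y hay => ?_⟩, ?_⟩
    · obtain ⟨i, hi⟩ := hy (y := Sum.inl y) (by simpa using hay)
      refine ⟨i, ?_⟩
      rw [hp] at hi
      simpa using hi
    · ext y
      by_contra hne
      obtain ⟨i, hi⟩ := hy (y := Sum.inr y) (by simpa using hne)
      rw [hp] at hi
      simp at hi
  · left
    refine ⟨?_, ⟨x, by simpa using hx, fun y hay => ?_⟩⟩
    · ext y
      by_contra hne
      obtain ⟨i, hi⟩ := hy (y := Sum.inl y) (by simpa using hne)
      rw [hp] at hi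
      simp at hi
    · obtain ⟨i, hi⟩ := hy (y := Sum.inr y) (by simpa using hay)
      refine ⟨i, ?_⟩
      rw [hp] at hi
      simpa using hi

/-- A cycle-preserving embedding gives independent sets in the sum. -/
lemma good_sum {A B : Type} [Fintype A] [Fintype B] [DecidableEq A] [DecidableEq B]
    (φ : Perm B →* Perm A)
    (hφ : ∀ g : Perm B, g.IsCycle → (φ g).IsCycle)
    (S : Finset (Perm A)) (hS : GoodSet A S) :
    ∃ T : Finset (Perm (A ⊕ B)), GoodSet (A ⊕ B) T ∧
      T.card = (Fintype.card B).factorial * S.card ∧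
      ∀ t ∈ T, ∃ s ∈ S, ∃ g : Perm B, t = Equiv.Perm.sumCongr (φ g * s) g := by
  classical
  have hmain : ∀ p : Perm B × Perm A, ∀ p' : Perm B × Perm A,
      (Equiv.Perm.sumCongr (φ p.1 * p.2) p.1)⁻¹ * Equiv.Perm.sumCongr (φ p'.1 * p'.2) p'.1
      = Equiv.Perm.sumCongr (p.2⁻¹ * φ (p.1⁻¹ * p'.1) * p'.2) (p.1⁻¹ * p'.1) := by
    intro p p'
    rw [Equiv.Perm.sumCongr_inv, Equiv.Perm.sumCongr_mul]
    simp [mul_assoc]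
  have hinj2 : Function.Injective
      (fun p : Perm B × Perm A => Equiv.Perm.sumCongr (φ p.1 * p.2) p.1) := by
    intro p p' h
    have h1 := Equiv.Perm.sumCongrHom_injective
      (a₁ := (φ p.1 * p.2, p.1)) (a₂ := (φ p'.1 * p'.2, p'.1)) h
    have h2 := congrArg Prod.fst h1
    have h3 := congrArg Prod.snd h1
    simp only at h2 h3
    rw [h3] at h2
    exact Prod.ext h3 (mul_left_cancel h2)
  refine ⟨(Finset.univ ×ˢ S).image
      (fun p : Perm B × Perm A => Equiv.Perm.sumCongr (φ p.1 * p.2) p.1), ?_, ?_, ?_⟩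
  · intro x hx y hy hne hc
    simp only [Finset.mem_image, Finset.mem_product, Finset.mem_univ, true_and] at hx hy
    obtain ⟨⟨g, s⟩, hs, rfl⟩ := hx
    obtain ⟨⟨g', t⟩, ht, rfl⟩ := hy
    rw [hmain] at hc
    simp only at hs ht hc
    rcases sumCongr_cycle _ _ hc with ⟨h1, h2⟩ | ⟨h1, h2⟩
    · have h3 := hφ _ h2
      have h4 : φ (g⁻¹ * g') = s * t⁻¹ := by
        rw [mul_assoc, inv_mul_eq_one] at h1
        exact eq_mul_inv_of_mul_eq h1.symm
      have hst : s ≠ t := by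
        rintro rfl
        rw [h4, mul_inv_cancel] at h3
        exact h3.ne_one rfl
      apply hS s hs t ht hst
      rw [h4] at h3
      have h5 := (h3.inv).conj (g := s⁻¹)
      convert h5 using 1
      group
    · have h3 : g = g' := inv_mul_eq_one.mp h2
      subst h3
      have hst : s ≠ t := by
        rintro rfl
        exact hne rfl
      apply hS s hs t ht hst
      simpa using h1
  · rw [Finset.card_image_of_injective _ hinj2, Finset.card_product, Finset.card_univ,
      Fintype.card_perm]
  · intro t ht
    simp only [Finset.mem_image, Finset.mem_product, Finset.mem_univ, true_and] at ht
    obtain ⟨⟨g, s⟩, hs, rfl⟩ := ht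
    exact ⟨s, hs, g, rfl⟩

lemma good_transfer {A B : Type} [Fintype A] [Fintype B] [DecidableEq A] [DecidableEq B]
    (e : A ≃ B) (S : Finset (Perm A)) (hS : GoodSet A S) :
    ∃ T : Finset (Perm B), GoodSet B T ∧ T.card = S.card ∧
      ((∀ s ∈ S, sign s = 1) → ∀ t ∈ T, sign t = 1) := by
  classical
  refine ⟨S.image (fun s => e.permCongrHom s), ?_, ?_, ?_⟩
  · intro x hx y hy hne hc
    simp only [Finset.mem_image] at hx hy
    obtain ⟨s, hs, rfl⟩ := hx
    obtain ⟨t, ht, rfl⟩ := hy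
    have hst : s ≠ t := by
      rintro rfl
      exact hne rfl
    apply hS s hs t ht hst
    rw [← map_inv, ← map_mul] at hc
    obtain ⟨x, hx, hy⟩ := hc
    have hp : ∀ i : ℤ, (e.permCongrHom (s⁻¹ * t)) ^ i = e.permCongrHom ((s⁻¹ * t) ^ i) :=
      fun i => (map_zpow _ _ i).symm
    refine ⟨e.symm x, ?_, ?_⟩
    · intro h
      apply hx
      rw [Equiv.eq_symm_apply] at h
      simpa using h
    · intro y hne
      obtain ⟨i, hi⟩ := hy (y := e y) (by simpa using hne)
      refine ⟨i, ?_⟩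
      rw [hp] at hi
      apply e.injective
      simpa using hi
  · exact Finset.card_image_of_injective _ (MulEquiv.injective _)
  · intro h t ht
    simp only [Finset.mem_image] at ht
    obtain ⟨s, hs, rfl⟩ := ht
    have := h s hs
    simpa [Equiv.Perm.sign_permCongr] using this

lemma good_double {A : Type} [Fintype A] [DecidableEq A] (hA : Even (Fintype.card A))
    (S : Finset (Perm A)) (hS : GoodSet A S) (hsgn : ∀ s ∈ S, sign s = 1) [Nonempty A] :
    ∃ T : Finset (Perm (A ⊕ A)), GoodSet (A ⊕ A) T ∧
      T.card = 2 * (Fintype.card A).factorial * S.card ∧ ∀ t ∈ T, sign t = 1 := by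
  classical
  obtain ⟨T, hT, hcard, hform⟩ := good_sum (MonoidHom.id (Perm A))
    (fun _ h => h) S hS
  have hTs : ∀ t ∈ T, sign t = 1 := by
    intro t ht
    obtain ⟨s, hs, g, rfl⟩ := hform t ht
    simp [Equiv.Perm.sign_sumCongr, hsgn s hs]
  let w : Perm (A ⊕ A) := Equiv.sumComm A A
  have hw : sign w = 1 := by
    have h2 : w ^ 2 = 1 := by
      ext x
      rcases x with x | x <;> simp [w, pow_two]
    have := Equiv.Perm.sign_of_pow_two_eq_one h2
    have hfix : IsEmpty (Function.fixedPoints w) := by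
      refine ⟨fun ⟨x, hx⟩ => ?_⟩
      rcases x with x | x <;> simp [w, Function.IsFixedPt] at hx
    rw [this, Fintype.card_sum, Fintype.card_eq_zero (α := Function.fixedPoints w), Nat.sub_zero]
    have h3 : (Fintype.card A + Fintype.card A) / 2 = Fintype.card A := by omega
    rw [h3]
    exact hA.neg_one_pow
  have hmix : ∀ x ∈ T, ∀ y ∈ T, ¬ (x⁻¹ * (y * w)).IsCycle := by
    intro x hx y hy hc
    have hs : sign (x⁻¹ * (y * w)) = 1 := by
      simp [hTs x hx, hTs y hy, hw]
    have hsupp : (x⁻¹ * (y * w)).support = Finset.univ := by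
      obtain ⟨s, hs, g, rfl⟩ := hform x hx
      obtain ⟨t, ht, g', rfl⟩ := hform y hy
      ext z
      rw [Equiv.Perm.sumCongr_inv]
      rcases z with z | z <;> simp [w]
    rw [hc.sign, hsupp, Finset.card_univ, Fintype.card_sum, (Even.add_self _).neg_one_pow] at hs
    exact absurd hs (by decide)
  have hdisj : Disjoint T (T.image (· * w)) := by
    rw [Finset.disjoint_left]
    intro x hx hx'
    obtain ⟨y, hy, rfl⟩ := Finset.mem_image.mp hx'
    obtain ⟨s, hs, g, h1⟩ := hform _ hx
    obtain ⟨t, ht, g', h2⟩ := hform _ hy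
    obtain ⟨a⟩ := ‹Nonempty A›
    have := congrArg (fun p : Perm (A ⊕ A) => p (Sum.inl a)) h1
    simp [h2, w] at this
  refine ⟨T ∪ T.image (· * w), ?_, ?_, ?_⟩
  · intro x hx y hy hne hc
    rw [Finset.mem_union, Finset.mem_image] at hx hy
    rcases hx with hx | ⟨x, hx, rfl⟩ <;> rcases hy with hy | ⟨y, hy, rfl⟩
    · exact hT x hx y hy hne hc
    · exact hmix x hx y hy hc
    · apply hmix y hy x hx
      have := hc.inv
      convert this using 1
      group
    · have hxy : x ≠ y := by
        rintro rfl
        exact hne rfl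
      apply hT x hx y hy hxy
      have := hc.conj (g := w)
      convert this using 1
      group
  · rw [Finset.card_union_of_disjoint hdisj,
      Finset.card_image_of_injective _ (mul_left_injective w), hcard]
    ring
  · intro t ht
    rw [Finset.mem_union, Finset.mem_image] at ht
    rcases ht with ht | ⟨y, hy, rfl⟩
    · exact hTs t ht
    · simp [hTs y hy, hw]

lemma good_pow (m : ℕ) : ∃ S : Finset (Perm (Fin (2 ^ (m + 1)))), GoodSet _ S ∧
    S.card = 2 ^ m * ∏ i ∈ Finset.Icc 1 m, (2 ^ i).factorial ∧ ∀ s ∈ S, sign s = 1 := by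
  induction m with
  | zero =>
    refine ⟨{1}, ?_, by simp, by simp⟩
    intro x hx y hy hne
    simp only [Finset.mem_singleton] at hx hy
    exact absurd (hx.trans hy.symm) hne
  | succ m ih =>
    obtain ⟨S, hS, hc, hs⟩ := ih
    haveI : Nonempty (Fin (2 ^ (m + 1))) := ⟨⟨0, by positivity⟩⟩
    obtain ⟨T, hT, hTc, hTs⟩ := good_double (by simp [pow_succ]) S hS hs
    obtain ⟨U, hU, hUc, hUs⟩ := good_transfer
      (finSumFinEquiv.trans (finCongr (by ring : 2 ^ (m + 1) + 2 ^ (m + 1) = 2 ^ (m + 1 + 1))))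
      T hT
    refine ⟨U, hU, ?_, hUs hTs⟩
    rw [hUc, hTc, hc, Fintype.card_fin, Finset.prod_Icc_succ_top (by omega)]
    ring

/-- Theorem 4.2: for `n = 2^m + q ≥ 4` with `0 ≤ q < 2^m`,
`α(n) ≥ q!·2^(m-1)·∏_{i=1}^{m-1} (2^i)!`. -/
theorem stmt12 (n m q : ℕ) (hn : 4 ≤ n) (hnq : n = 2 ^ m + q) (hq : q < 2 ^ m) :
    q.factorial * 2 ^ (m - 1) * ∏ i ∈ Finset.Icc 1 (m - 1), (2 ^ i).factorial ≤
      birkhoffIndepNum n := by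
  subst hnq
  obtain ⟨k, rfl⟩ : ∃ k, m = k + 1 := by
    rcases m with _ | k
    · simp at hq
      omega
    · exact ⟨k, rfl⟩
  obtain ⟨S, hS, hc, -⟩ := good_pow k
  let ι : Fin q ↪ Fin (2 ^ (k + 1)) := Fin.castLEEmb hq.le
  obtain ⟨T, hT, hTc, -⟩ := good_sum (Equiv.Perm.viaEmbeddingHom ι)
    (fun g hg => by
      rw [Equiv.Perm.viaEmbeddingHom_apply]
      unfold Equiv.Perm.viaEmbedding
      exact @Equiv.Perm.IsCycle.extendDomain _ _ _ _ (Classical.decPred _) _ hg) S hS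
  obtain ⟨U, hU, hUc, -⟩ := good_transfer finSumFinEquiv T hT
  unfold birkhoffIndepNum
  apply le_csSup
  · refine ⟨Fintype.card (Perm (Fin (2 ^ (k + 1) + q))), ?_⟩
    rintro _ ⟨V, -, rfl⟩
    exact Finset.card_le_univ V
  · refine ⟨U, fun x hx y hy hne => hU x hx y hy hne, ?_⟩
    rw [hUc, hTc, hc, Fintype.card_fin, Nat.add_sub_cancel]
    ring
end

section
/- Let n ≥ k ≥ 1 be integers and let I ⊆ Sym(n) be an independent set of the Birkhoff polytope graph G(Ω_n). Embed Sym(n) into Sym(n+k) as the permutations fixing {n+1,…,n+k}, and for each ρ ∈ Sym(k) let ρ̂ ∈ Sym(n+k) be the permutation acting as ρ on {1,…,k}, fixing {k+1,…,n}, and sending n+i to n+ρ(i) for 1 ≤ i ≤ k. Then the set L = { σ∘ρ̂ restricted suitably, namely the permutation of {1,…,n+k} acting as σ∘ρ on {1,…,k} and as σ on {k+1,…,n} and sending n+i ↦ n+ρ(i), for σ ∈ I and ρ ∈ Sym(k) } is an independent set of G(Ω_{n+k}) of cardinality |I| · k!. -/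
/-- The embedding of `Fin a` in `Fin b` (for `a ≤ b`) preserving values. -/
def finEmbLe {a b : ℕ} (h : a ≤ b) : Fin a ↪ Fin b :=
  ⟨fun i => ⟨(i : ℕ), lt_of_lt_of_le i.isLt h⟩,
   fun x y hxy => by
     have h' := congrArg Fin.val hxy
     exact Fin.ext h'⟩

/-- Extend a permutation of `Fin k` to a permutation of `Fin n` (for `k ≤ n`), fixing
all the points `k,…,n-1`. -/
def permExtendLow {k n : ℕ} (h : k ≤ n) (ρ : Equiv.Perm (Fin k)) : Equiv.Perm (Fin n) :=
  ρ.viaFintypeEmbedding (finEmbLe h)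

open Equiv Equiv.Perm in
lemma sumCycle_aux {α β : Type*} (x : Perm α) (y : Perm β) (h : (Perm.sumCongr x y).IsCycle) :
    (x = 1 ∧ y.IsCycle) ∨ (y = 1 ∧ x.IsCycle) := by
  have hz : ∀ i : ℤ, (Perm.sumCongr x y : Perm (α ⊕ β)) ^ i = Perm.sumCongr (x ^ i) (y ^ i) := by
    intro i
    exact (map_zpow (sumCongrHom α β) (x, y) i).symm
  obtain ⟨a, ha, hb⟩ := h
  rcases a with a | b
  · right
    refine ⟨?_, a, by simpa using ha, ?_⟩
    · ext c
      by_contra hc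
      obtain ⟨i, hi⟩ := @hb (Sum.inr c) (by simpa using hc)
      rw [hz] at hi
      simp at hi
    · intro c hc
      obtain ⟨i, hi⟩ := @hb (Sum.inl c) (by simpa using hc)
      rw [hz] at hi
      exact ⟨i, by simpa using hi⟩
  · left
    refine ⟨?_, b, by simpa using ha, ?_⟩
    · ext c
      by_contra hc
      obtain ⟨i, hi⟩ := @hb (Sum.inl c) (by simpa using hc)
      rw [hz] at hi
      simp at hi
    · intro c hc
      obtain ⟨i, hi⟩ := @hb (Sum.inr c) (by simpa using hc)
      rw [hz] at hi
      exact ⟨i, by simpa using hi⟩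

lemma permOplus_eq {a b : ℕ} (x : Equiv.Perm (Fin a)) (y : Equiv.Perm (Fin b)) :
    permOplus x y = finSumFinEquiv.permCongrHom (Equiv.Perm.sumCongrHom _ _ (x, y)) := rfl

lemma permCongr_cycle {α β : Type*} (e : α ≃ β) (f : Equiv.Perm α)
    (h : (e.permCongrHom f).IsCycle) : f.IsCycle := by
  obtain ⟨a, ha, hb⟩ := h
  refine ⟨e.symm a, ?_, ?_⟩
  · intro h
    apply ha
    simp [Equiv.permCongrHom, h]
  · intro y hy
    obtain ⟨i, hi⟩ := @hb (e y) (by simpa [Equiv.permCongrHom] using hy)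
    rw [← map_zpow] at hi
    exact ⟨i, by simpa [Equiv.permCongrHom] using hi⟩

lemma permOplus_cycle {a b : ℕ} (x : Equiv.Perm (Fin a)) (y : Equiv.Perm (Fin b))
    (h : (permOplus x y).IsCycle) : (x = 1 ∧ y.IsCycle) ∨ (y = 1 ∧ x.IsCycle) :=
  sumCycle_aux x y (permCongr_cycle finSumFinEquiv _ h)

lemma permOplus_inv_mul {a b : ℕ} (x x' : Equiv.Perm (Fin a)) (y y' : Equiv.Perm (Fin b)) :
    (permOplus x y)⁻¹ * permOplus x' y' = permOplus (x⁻¹ * x') (y⁻¹ * y') := by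
  simp only [permOplus_eq]
  rw [← map_inv, ← map_inv, ← map_mul, ← map_mul]
  rfl

lemma permOplus_inj {a b : ℕ} {x x' : Equiv.Perm (Fin a)} {y y' : Equiv.Perm (Fin b)}
    (h : permOplus x y = permOplus x' y') : x = x' ∧ y = y' := by
  simp only [permOplus_eq] at h
  have := Equiv.Perm.sumCongrHom_injective ((MulEquiv.injective _) h)
  simpa using this

lemma permExtendLow_mul {k n : ℕ} (h : k ≤ n) (ρ π : Equiv.Perm (Fin k)) :
    permExtendLow h (ρ * π) = permExtendLow h ρ * permExtendLow h π :=
  (Equiv.Perm.extendDomain_mul _ _ _).symm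

lemma permExtendLow_inv {k n : ℕ} (h : k ≤ n) (ρ : Equiv.Perm (Fin k)) :
    permExtendLow h ρ⁻¹ = (permExtendLow h ρ)⁻¹ :=
  (Equiv.Perm.extendDomain_inv _ _).symm

lemma permExtendLow_cycle {k n : ℕ} (h : k ≤ n) (ρ : Equiv.Perm (Fin k)) (hρ : ρ.IsCycle) :
    (permExtendLow h ρ).IsCycle :=
  Equiv.Perm.IsCycle.extendDomain _ hρ

/-- Proposition 4.4 (a): if `I` is an independent set of `G(Ω_n)` and `1 ≤ k ≤ n`, then
`L = { (σ·ρ̂) ⊕ ρ : σ ∈ I, ρ ∈ Sym(k) }` (where `ρ̂` is `ρ` extended to `n` points by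
the identity) is an independent set of `G(Ω_{n+k})` of cardinality `|I|·k!`. -/
theorem stmt14 (n k : ℕ) (hk : 1 ≤ k) (hkn : k ≤ n)
    (I : Set (Equiv.Perm (Fin n))) (hI : IsBIndep I) :
    IsBIndep {π : Equiv.Perm (Fin (n + k)) |
      ∃ σ ∈ I, ∃ ρ : Equiv.Perm (Fin k), π = permOplus (σ * permExtendLow hkn ρ) ρ} ∧
    {π : Equiv.Perm (Fin (n + k)) |
      ∃ σ ∈ I, ∃ ρ : Equiv.Perm (Fin k), π = permOplus (σ * permExtendLow hkn ρ) ρ}.ncard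
      = I.ncard * k.factorial := by
  constructor
  · rintro _ ⟨σ, hσ, ρ, rfl⟩ _ ⟨τ, hτ, π, rfl⟩ - hc
    have key : ¬ (σ⁻¹ * τ).IsCycle := by
      by_cases h : σ = τ
      · subst h
        intro h
        exact h.ne_one (by simp)
      · exact hI hσ hτ h
    apply key
    rw [permOplus_inv_mul] at hc
    rcases permOplus_cycle _ _ hc with ⟨h1, h2⟩ | ⟨h1, h2⟩
    · have e : σ⁻¹ * τ = permExtendLow hkn (π * (ρ⁻¹ * π)⁻¹ * π⁻¹) := by
        have h3 := inv_mul_eq_one.mp h1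
        have h4 : τ = σ * permExtendLow hkn ρ * (permExtendLow hkn π)⁻¹ := by
          rw [h3]; group
        rw [h4]
        simp only [permExtendLow_mul, permExtendLow_inv]
        group
      rw [e]
      exact permExtendLow_cycle _ _ (h2.inv.conj)
    · have h3 := inv_mul_eq_one.mp h1
      subst h3
      have := h2.conj (g := permExtendLow hkn ρ)
      convert this using 1
      group
  · have e : {π : Equiv.Perm (Fin (n + k)) |
        ∃ σ ∈ I, ∃ ρ : Equiv.Perm (Fin k), π = permOplus (σ * permExtendLow hkn ρ) ρ} =
        (fun p : Equiv.Perm (Fin n) × Equiv.Perm (Fin k) =>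
          permOplus (p.1 * permExtendLow hkn p.2) p.2) '' (I ×ˢ Set.univ) := by
      ext π
      constructor
      · rintro ⟨σ, hσ, ρ, rfl⟩
        exact ⟨(σ, ρ), ⟨hσ, trivial⟩, rfl⟩
      · rintro ⟨⟨σ, ρ⟩, ⟨hσ, -⟩, rfl⟩
        exact ⟨σ, hσ, ρ, rfl⟩
    rw [e, Set.ncard_image_of_injective, Set.ncard_prod, Set.ncard_univ, Nat.card_eq_fintype_card,
      Fintype.card_perm, Fintype.card_fin]
    rintro ⟨σ, ρ⟩ ⟨τ, π⟩ h
    obtain ⟨h1, h2⟩ := permOplus_inj h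
    simp only at h1 h2
    subst h2
    rw [mul_right_cancel h1]
end
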